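/- arXiv:2001.03312 — 4 statements merged into one kernel-verified Lean document; each statement's English description precedes it below -/
import Mathlib

section
/- Every finite direct sum of quotient finite-dimensional modules is a quotient finite-dimensional module: if M₁, …, Mₙ are right modules over a ring A each of whose factor modules is finite-dimensional, then every factor module of M₁ ⊕ ⋯ ⊕ Mₙ is finite-dimensional. -/
/-- A module is *uniserial* if any two of its submodules are comparable with
respect to inclusion. -/
def IsUniserialModule (R M : Type*) [Ring R] [AddCommGroup M] [Module R M] : Prop :=
  ∀ N₁ N₂ : Submodule R M, N₁ ≤ N₂ ∨ N₂ ≤ N₁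

/-- A ring `A` is *right serial* if `A` is a finite direct sum of uniserial right
ideals, i.e. the right module `A_A` is a serial module.  Right ideals of `A` are
the submodules of `A` viewed as a right module over itself, i.e. as a module
over the opposite ring `Aᵐᵒᵖ`. -/
def IsRightSerialRing (A : Type*) [Ring A] : Prop :=
  ∃ (ι : Type) (_ : Fintype ι) (N : ι → Submodule Aᵐᵒᵖ A),
    iSupIndep N ∧ (⨆ i, N i) = ⊤ ∧ ∀ i, IsUniserialModule Aᵐᵒᵖ (N i)

/-- A ring `A` is *left serial* if `A` is a finite direct sum of uniserial left
ideals, i.e. the left module `_AA` is a serial module. -/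
def IsLeftSerialRing (A : Type*) [Ring A] : Prop :=
  ∃ (ι : Type) (_ : Fintype ι) (N : ι → Submodule A A),
    iSupIndep N ∧ (⨆ i, N i) = ⊤ ∧ ∀ i, IsUniserialModule A (N i)

/-- A module `M` is *finite-dimensional* if it contains no infinite direct sum of
nonzero submodules, i.e. there is no infinite independent family of nonzero
submodules of `M`. -/
def IsFinDimModule (R M : Type*) [Ring R] [AddCommGroup M] [Module R M] : Prop :=
  ¬ ∃ (ι : Type) (_ : Infinite ι) (N : ι → Submodule R M),
      (∀ i, N i ≠ ⊥) ∧ iSupIndep N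

/-- A module `M` is *quotient finite-dimensional* if every factor module of `M`
is finite-dimensional. -/
def IsQFDModule (R M : Type*) [Ring R] [AddCommGroup M] [Module R M] : Prop :=
  ∀ N : Submodule R M, IsFinDimModule R (M ⧸ N)

section FinDim

variable {R M M₂ : Type*} [Ring R] [AddCommGroup M] [Module R M] [AddCommGroup M₂] [Module R M₂]

/-- Grouping an independent family into disjoint blocks gives an independent family. -/
theorem iSupIndep.biSup_of_pairwise_disjoint {α ι κ : Type*} [CompleteLattice α]
    [IsModularLattice α] [IsCompactlyGenerated α] {t : ι → α} (ht : iSupIndep t)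
    {J : κ → Set ι} (hJ : Pairwise (Function.onFun Disjoint J)) :
    iSupIndep fun k ↦ ⨆ i ∈ J k, t i := by
  intro k
  have hdisj : Disjoint (J k) (⋃ j, ⋃ (_ : j ≠ k), J j) := by
    simp only [Set.disjoint_iUnion_right]
    exact fun j hj ↦ hJ hj.symm
  refine (ht.disjoint_biSup_biSup hdisj).mono_right ?_
  refine iSup₂_le fun j hj ↦ biSup_mono fun i hi ↦ ?_
  exact Set.mem_iUnion₂.2 ⟨j, hj, hi⟩

theorem iSupIndep.of_submodule_map {ι : Type*} (f : M →ₗ[R] M₂) (hf : Function.Injective f)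
    {N : ι → Submodule R M} (h : iSupIndep fun i ↦ (N i).map f) : iSupIndep N := by
  intro i
  have hi := h i
  simp only [← Submodule.map_iSup] at hi
  rw [disjoint_iff, ← Submodule.map_inf f hf, ← LinearMap.le_ker_iff_map,
    LinearMap.ker_eq_bot.2 hf, le_bot_iff] at hi
  exact disjoint_iff.2 hi

theorem iSupIndep.submodule_map_of_disjoint_ker {ι : Type*} (f : M →ₗ[R] M₂)
    {N : ι → Submodule R M} (h : iSupIndep N) (hf : Disjoint (LinearMap.ker f) (⨆ i, N i)) :
    iSupIndep fun i ↦ (N i).map f := by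
  intro i
  simp only [← Submodule.map_iSup]
  rw [Submodule.disjoint_def]
  rintro _ ⟨a, ha, rfl⟩ ⟨b, hb, hab⟩
  have hb' : b ∈ ⨆ i, N i := iSup₂_le_iSup _ N hb
  have hsub : a - b = 0 := Submodule.disjoint_def.1 hf _ (by simp [hab])
    (sub_mem (le_iSup N i ha) hb')
  rw [sub_eq_zero] at hsub
  subst hsub
  rw [Submodule.disjoint_def.1 (h i) a ha hb, map_zero]

theorem IsFinDimModule.of_injective (h : IsFinDimModule R M₂) (f : M →ₗ[R] M₂)
    (hf : Function.Injective f) : IsFinDimModule R M := by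
  rintro ⟨ι, hι, N, hN, hind⟩
  refine h ⟨ι, hι, fun i ↦ (N i).map f, fun i ↦ ?_, f.iSupIndep_map hf hind⟩
  simpa [← LinearMap.le_ker_iff_map, LinearMap.ker_eq_bot.2 hf] using hN i

theorem exists_monotone_biSup_Ico_not_disjoint {α : Type*} [CompleteLattice α]
    [IsCompactlyGenerated α] {t : ℕ → α} {b : α}
    (h : ∀ n, ¬ Disjoint b (⨆ i ∈ Set.Ici n, t i)) :
    ∃ a : ℕ → ℕ, Monotone a ∧ ∀ k, ¬ Disjoint b (⨆ i ∈ Set.Ico (a k) (a (k + 1)), t i) := by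
  have step : ∀ n, ∃ m, n ≤ m ∧ ¬ Disjoint b (⨆ i ∈ Set.Ico n m, t i) := by
    intro n
    by_contra! hn
    refine h n (disjoint_biSup_of_finite_disjoint_biSup fun s hs hfin ↦ ?_).symm
    obtain ⟨m, hm⟩ := hfin.bddAbove
    refine (hn (max n (m + 1)) (le_max_left _ _)).symm.mono_left (biSup_mono fun i hi ↦ ?_)
    exact ⟨hs hi, lt_max_of_lt_right (Nat.lt_succ_of_le (hm hi))⟩
  choose f hf hd using step
  refine ⟨fun k ↦ f^[k] 0, monotone_nat_of_le_succ fun k ↦ ?_, fun k ↦ ?_⟩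
  · rw [Function.iterate_succ_apply']
    exact hf _
  · simp only [Function.iterate_succ_apply']
    exact hd _

/-- Finite-dimensional modules are closed under extensions. -/
theorem IsFinDimModule.of_submodule_quotient (K : Submodule R M) (hK : IsFinDimModule R K)
    (hQ : IsFinDimModule R (M ⧸ K)) : IsFinDimModule R M := by
  rintro ⟨ι, hι, N', hN', hind'⟩
  obtain ⟨N, hN, hind⟩ : ∃ N : ℕ → Submodule R M, (∀ i, N i ≠ ⊥) ∧ iSupIndep N :=
    ⟨_, fun i ↦ hN' (Infinite.natEmbedding ι i),
      hind'.comp (Infinite.natEmbedding ι).injective⟩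
  by_cases h : ∃ n, Disjoint K (⨆ i ∈ Set.Ici n, N i)
  · obtain ⟨n, hn⟩ := h
    have hle : ⨆ i, N (n + i) ≤ ⨆ i ∈ Set.Ici n, N i :=
      iSup_le fun i ↦ le_iSup₂_of_le (n + i) (Nat.le_add_right n i) le_rfl
    have hd : Disjoint (LinearMap.ker K.mkQ) (⨆ i, N (n + i)) := by
      rw [Submodule.ker_mkQ]
      exact hn.mono_right hle
    refine hQ ⟨ℕ, inferInstance, fun i ↦ (N (n + i)).map K.mkQ, fun i hi ↦ hN (n + i) ?_,
      (hind.comp (add_right_injective n)).submodule_map_of_disjoint_ker _ hd⟩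
    simp only [← LinearMap.le_ker_iff_map] at hi
    exact (hd.symm.mono_left (le_iSup (fun i ↦ N (n + i)) i)).eq_bot_of_le hi
  · push Not at h
    obtain ⟨a, ha, hd⟩ := exists_monotone_biSup_Ico_not_disjoint h
    refine hK ⟨ℕ, inferInstance,
      fun k ↦ (⨆ i ∈ Set.Ico (a k) (a (k + 1)), N i).comap K.subtype, fun k hk ↦ hd k ?_, ?_⟩
    · dsimp only at hk
      rw [disjoint_iff, ← Submodule.map_comap_subtype, hk, Submodule.map_bot]
    · refine iSupIndep.of_submodule_map K.subtype K.injective_subtype ?_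
      exact (hind.biSup_of_pairwise_disjoint ha.pairwise_disjoint_on_Ico_succ).mono
        fun k ↦ Submodule.map_comap_le _ _

theorem IsQFDModule.isFinDimModule_of_surjective (h : IsQFDModule R M) (f : M →ₗ[R] M₂)
    (hf : Function.Surjective f) : IsFinDimModule R M₂ :=
  (h (LinearMap.ker f)).of_injective (f.quotKerEquivOfSurjective hf).symm.toLinearMap
    (f.quotKerEquivOfSurjective hf).symm.injective

theorem IsQFDModule.of_surjective (h : IsQFDModule R M) (f : M →ₗ[R] M₂)
    (hf : Function.Surjective f) : IsQFDModule R M₂ := fun N ↦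
  h.isFinDimModule_of_surjective (N.mkQ ∘ₗ f) (N.mkQ_surjective.comp hf)

theorem isQFDModule_of_subsingleton [Subsingleton M] : IsQFDModule R M := by
  rintro N ⟨ι, hι, P, hP, -⟩
  exact hP (Classical.arbitrary ι) (Subsingleton.elim _ _)

theorem IsQFDModule.sup {P Q : Submodule R M} (hP : IsQFDModule R P) (hQ : IsQFDModule R Q) :
    IsQFDModule R (P ⊔ Q : Submodule R M) := by
  intro N
  let f : P →ₗ[R] (P ⊔ Q : Submodule R M) ⧸ N := N.mkQ ∘ₗ Submodule.inclusion le_sup_left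
  let g : Q →ₗ[R] (P ⊔ Q : Submodule R M) ⧸ N := N.mkQ ∘ₗ Submodule.inclusion le_sup_right
  refine .of_submodule_quotient (LinearMap.range f)
    (hP.isFinDimModule_of_surjective f.rangeRestrict f.surjective_rangeRestrict)
    (hQ.isFinDimModule_of_surjective ((LinearMap.range f).mkQ ∘ₗ g) fun y ↦ ?_)
  obtain ⟨y, rfl⟩ := Submodule.mkQ_surjective _ y
  obtain ⟨⟨x, hx⟩, rfl⟩ := Submodule.mkQ_surjective _ y
  obtain ⟨p, hp, q, hq, rfl⟩ := Submodule.mem_sup.1 hx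
  refine ⟨⟨q, hq⟩, ?_⟩
  have hsum : N.mkQ ⟨p + q, hx⟩ = f ⟨p, hp⟩ + g ⟨q, hq⟩ := by
    simp only [f, g, LinearMap.comp_apply, ← map_add]
    rfl
  rw [hsum, map_add, LinearMap.comp_apply, right_eq_add]
  simp

theorem IsQFDModule.finset_sup {ι : Type*} (s : Finset ι) (P : ι → Submodule R M)
    (hP : ∀ i ∈ s, IsQFDModule R (P i)) : IsQFDModule R (s.sup P : Submodule R M) :=
  Finset.sup_induction (p := fun Q : Submodule R M ↦ IsQFDModule R Q)
    isQFDModule_of_subsingleton (fun _ h₁ _ h₂ ↦ h₁.sup h₂) hP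

end FinDim

/-- Every finite direct sum of quotient finite-dimensional modules is a quotient
finite-dimensional module. -/
theorem isQFDModule_pi (A : Type*) [Ring A] (ι : Type*) [Fintype ι]
    (M : ι → Type*) [∀ i, AddCommGroup (M i)] [∀ i, Module Aᵐᵒᵖ (M i)]
    (h : ∀ i, IsQFDModule Aᵐᵒᵖ (M i)) :
    IsQFDModule Aᵐᵒᵖ (∀ i, M i) := by
  classical
  have hsup : IsQFDModule Aᵐᵒᵖ (Finset.univ.sup fun i ↦
      LinearMap.range (LinearMap.single Aᵐᵒᵖ M i) : Submodule Aᵐᵒᵖ (∀ i, M i)) :=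
    .finset_sup _ _ fun i _ ↦ (h i).of_surjective _ (LinearMap.surjective_rangeRestrict _)
  rw [Finset.sup_univ_eq_iSup, LinearMap.iSup_range_single] at hsup
  exact hsup.of_surjective Submodule.topEquiv.toLinearMap Submodule.topEquiv.surjective
end

section
/- Every cyclic right module over a right serial ring is quotient finite-dimensional: if A is a right serial ring and M is a cyclic right A-module (generated by a single element), then every factor module of M is finite-dimensional (contains no infinite direct sum of nonzero submodules). -/
section Lattice

variable {α : Type*} [CompleteLattice α]

/-- There is no infinite independent family of nonzero elements below `k`. -/
def HasFinUniformDim (k : α) : Prop :=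
  ∀ f : ℕ → α, (∀ i, f i ≠ ⊥) → (∀ i, f i ≤ k) → ¬ iSupIndep f

theorem hasFinUniformDim_bot : HasFinUniformDim (⊥ : α) :=
  fun _ hne hle _ => hne 0 (le_bot_iff.mp (hle 0))

theorem iSupIndep.sup_even_odd [IsModularLattice α] {f : ℕ → α} (hf : iSupIndep f) :
    iSupIndep fun i => f (2 * i) ⊔ f (2 * i + 1) := by
  intro i
  have h := hf.disjoint_biSup_biSup' (s := {2 * i, 2 * i + 1})
    (t := {j | j ≠ 2 * i ∧ j ≠ 2 * i + 1})
    (Set.disjoint_left.mpr fun j hj hj' => hj.elim hj'.1 hj'.2) (Set.toFinite _)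
  refine h.mono ?_ (iSup₂_le fun j hj => sup_le ?_ ?_)
  · rw [iSup_pair]
  · exact le_biSup f (show 2 * j ≠ 2 * i ∧ 2 * j ≠ 2 * i + 1 by omega)
  · exact le_biSup f (show 2 * j + 1 ≠ 2 * i ∧ 2 * j + 1 ≠ 2 * i + 1 by omega)

theorem not_disjoint_sup_of_sup_le_sup [IsModularLattice α] {k x y : α} (hx : x ≠ ⊥)
    (hxy : Disjoint x y) (h : x ⊔ k ≤ y ⊔ k) : ¬ Disjoint (x ⊔ y) k := by
  intro hd
  have hle : x ≤ (y ⊔ k) ⊓ (x ⊔ y) := le_inf (le_sup_left.trans h) le_sup_left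
  rw [sup_inf_assoc_of_le k (le_sup_right : y ≤ x ⊔ y), hd.symm.eq_bot, sup_bot_eq] at hle
  exact hx (hxy.eq_bot_of_le hle)

theorem sup_le_sup_total_of_le_sup [IsModularLattice α] {k u x y : α}
    (hu : ∀ a ≤ u, ∀ b ≤ u, a ≤ b ∨ b ≤ a) (hx : x ≤ k ⊔ u) (hy : y ≤ k ⊔ u) :
    x ⊔ k ≤ y ⊔ k ∨ y ⊔ k ≤ x ⊔ k := by
  have key : ∀ z ≤ k ⊔ u, z ⊔ k = k ⊔ u ⊓ (z ⊔ k) := fun z hz => by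
    rw [← sup_inf_assoc_of_le u (le_sup_right : k ≤ z ⊔ k),
      inf_eq_right.mpr (sup_le hz le_sup_left)]
  rw [key x hx, key y hy]
  exact (hu _ inf_le_left _ inf_le_left).imp (sup_le_sup_left · k) (sup_le_sup_left · k)

theorem HasFinUniformDim.sup [IsModularLattice α] {k u : α} (hk : HasFinUniformDim k)
    (hu : ∀ a ≤ u, ∀ b ≤ u, a ≤ b ∨ b ≤ a) : HasFinUniformDim (k ⊔ u) := by
  intro f hne hle hf
  refine hk (fun i => (f (2 * i) ⊔ f (2 * i + 1)) ⊓ k) (fun i h => ?_) (fun _ => inf_le_right)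
    (hf.sup_even_odd.mono fun _ => inf_le_left)
  have hxy : Disjoint (f (2 * i)) (f (2 * i + 1)) := hf.pairwiseDisjoint (by omega)
  rcases sup_le_sup_total_of_le_sup hu (hle (2 * i)) (hle (2 * i + 1)) with h' | h'
  · exact not_disjoint_sup_of_sup_le_sup (hne _) hxy h' (disjoint_iff.mpr h)
  · exact not_disjoint_sup_of_sup_le_sup (hne _) hxy.symm h' (sup_comm (f (2 * i)) _ ▸
      disjoint_iff.mpr h)

theorem hasFinUniformDim_finset_sup [IsModularLattice α] {ι : Type*} (s : Finset ι) (u : ι → α)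
    (hu : ∀ i, ∀ a ≤ u i, ∀ b ≤ u i, a ≤ b ∨ b ≤ a) : HasFinUniformDim (s.sup u) := by
  classical
  induction s using Finset.induction_on with
  | empty => exact hasFinUniformDim_bot
  | insert i s _ ih =>
    rw [Finset.sup_insert, sup_comm]
    exact ih.sup (hu i)

end Lattice

section Module

variable {R M M' : Type*} [Ring R] [AddCommGroup M] [Module R M] [AddCommGroup M'] [Module R M']

theorem isFinDimModule_of_hasFinUniformDim_top
    (h : HasFinUniformDim (⊤ : Submodule R M)) : IsFinDimModule R M := by
  rintro ⟨ι, _, N, hne, hN⟩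
  let e := Infinite.natEmbedding ι
  exact h (N ∘ e) (fun i => hne (e i)) (fun _ => le_top) (hN.comp e.injective)

theorem IsUniserialModule.le_total_of_le_map {N : Submodule R M}
    (hN : IsUniserialModule R N) (g : M →ₗ[R] M') {P Q : Submodule R M'}
    (hP : P ≤ N.map g) (hQ : Q ≤ N.map g) : P ≤ Q ∨ Q ≤ P := by
  have key : ∀ P ≤ N.map g, (P.comap (g ∘ₗ N.subtype)).map (g ∘ₗ N.subtype) = P := fun P hP =>
    Submodule.map_comap_eq_of_le (by rwa [LinearMap.range_comp, Submodule.range_subtype])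
  rw [← key P hP, ← key Q hQ]
  exact (hN _ _).imp Submodule.map_mono Submodule.map_mono

theorem isFinDimModule_of_surjective_of_iSup_eq_top {ι : Type*} [Fintype ι]
    {N : ι → Submodule R M} (htop : ⨆ i, N i = ⊤) (hN : ∀ i, IsUniserialModule R (N i))
    (g : M →ₗ[R] M') (hg : Function.Surjective g) : IsFinDimModule R M' := by
  have h := hasFinUniformDim_finset_sup Finset.univ (fun i => (N i).map g)
    fun i _ hP _ hQ => (hN i).le_total_of_le_map g hP hQ
  rw [Finset.sup_univ_eq_iSup, ← Submodule.map_iSup, htop, Submodule.map_top,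
    LinearMap.range_eq_top.mpr hg] at h
  exact isFinDimModule_of_hasFinUniformDim_top h

end Module

/-- Every cyclic right module over a right serial ring is quotient
finite-dimensional. -/
theorem isQFDModule_of_cyclic_of_rightSerial (A : Type*) [Ring A]
    (hA : IsRightSerialRing A)
    (M : Type*) [AddCommGroup M] [Module Aᵐᵒᵖ M]
    (hM : ∃ m : M, Submodule.span Aᵐᵒᵖ {m} = ⊤) :
    IsQFDModule Aᵐᵒᵖ M := by
  obtain ⟨ι, _, U, -, htop, hU⟩ := hA
  obtain ⟨m, hm⟩ := hM
  intro N
  let g : A →ₗ[Aᵐᵒᵖ] M :=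
    { toFun := fun a => MulOpposite.op a • m
      map_add' := fun a b => by rw [MulOpposite.op_add, add_smul]
      map_smul' := fun r a => by
        rw [RingHom.id_apply, smul_smul, MulOpposite.smul_eq_mul_unop, MulOpposite.op_mul,
          MulOpposite.op_unop] }
  have hg : Function.Surjective g := fun x => by
    obtain ⟨r, rfl⟩ := Submodule.mem_span_singleton.mp (hm ▸ Submodule.mem_top : x ∈ _)
    exact ⟨r.unop, rfl⟩
  exact isFinDimModule_of_surjective_of_iSup_eq_top htop hU (N.mkQ ∘ₗ g)
    (N.mkQ_surjective.comp hg)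
end

section
/- Let A be a (not necessarily commutative) ring and let R = A((x)) be the Laurent series ring over A. Every cyclic right R-module is finite-dimensional (contains no infinite direct sum of nonzero submodules) if and only if R is a right Noetherian ring, and this holds if and only if A is a right Noetherian ring. -/
universe u

/-- If no submodule of a family lies in the supremum of the others, then some quotient of the
ambient module contains an independent family of nonzero submodules with the same index set. -/
theorem exists_quotient_iSupIndep {R M ι : Type*} [Ring R] [AddCommGroup M] [Module R M]
    (P : ι → Submodule R M) (hP : ∀ i, ¬ P i ≤ ⨆ (j) (_ : j ≠ i), P j) :
    ∃ J : Submodule R M, (∀ i, (P i).map J.mkQ ≠ ⊥) ∧ iSupIndep fun i => (P i).map J.mkQ := by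
  let Q : ι → Submodule R M := fun i => ⨆ (j) (_ : j ≠ i), P j
  let J : Submodule R M := ⨆ i, P i ⊓ Q i
  have hJQ : ∀ i, J ≤ Q i := by
    intro i
    refine iSup_le fun j => ?_
    by_cases h : j = i
    · subst h
      exact inf_le_right
    · exact inf_le_left.trans (le_iSup₂_of_le j h le_rfl)
  refine ⟨J, fun i hi => hP i ?_, fun i => ?_⟩
  · rw [← le_bot_iff, Submodule.map_le_iff_le_comap, ← LinearMap.ker, Submodule.ker_mkQ] at hi
    exact hi.trans (hJQ i)
  · have hQ : (⨆ (j) (_ : j ≠ i), (P j).map J.mkQ) = (Q i).map J.mkQ := by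
      simp only [Q, Submodule.map_iSup]
    rw [hQ, Submodule.disjoint_def]
    rintro _ ⟨p, hp, rfl⟩ ⟨q, hq, hpq⟩
    have hsub : p - q ∈ J := by
      rw [← Submodule.Quotient.eq]
      exact hpq.symm
    have hpQ : p ∈ Q i := by
      simpa using (Q i).add_mem (hJQ i hsub) hq
    have hpJ : p ∈ J := (le_iSup (fun i => P i ⊓ Q i) i) ⟨hp, hpQ⟩
    simpa using hpJ

/-- A non-Noetherian module contains a sequence, each term of which avoids the corresponding
term of an increasing chain of submodules containing all the earlier terms. -/
theorem exists_seq_notMem_of_not_isNoetherian {R M : Type*} [Ring R] [AddCommGroup M]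
    [Module R M] (h : ¬ IsNoetherian R M) :
    ∃ (I : ℕ → Submodule R M) (a : ℕ → M), Monotone I ∧
      ∀ k, a k ∈ I (k + 1) ∧ a k ∉ I k := by
  rw [isNoetherian_iff, RelEmbedding.wellFounded_iff_isEmpty, not_isEmpty_iff] at h
  obtain ⟨f⟩ := h
  have hf : StrictMono f := fun m n hmn => f.map_rel_iff.2 hmn
  choose a ha ha' using fun k => SetLike.exists_of_lt (hf (Nat.lt_succ_self k))
  exact ⟨f, a, hf.monotone, fun k => ⟨ha k, ha' k⟩⟩

/-- A cyclic module over a right Noetherian ring is Noetherian. -/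
theorem isNoetherian_of_span_singleton_eq_top {R M : Type*} [Ring R] [AddCommGroup M]
    [Module Rᵐᵒᵖ M] [IsNoetherian Rᵐᵒᵖ R] {m : M} (hm : Submodule.span Rᵐᵒᵖ {m} = ⊤) :
    IsNoetherian Rᵐᵒᵖ M := by
  let φ : R →ₗ[Rᵐᵒᵖ] M :=
    { toFun := fun r => MulOpposite.op r • m
      map_add' := fun r s => by rw [MulOpposite.op_add, add_smul]
      map_smul' := fun s r => by simp [← mul_smul] }
  refine isNoetherian_of_surjective φ (LinearMap.range_eq_top.2 fun y => ?_)
  have hy : y ∈ Submodule.span Rᵐᵒᵖ {m} := hm ▸ Submodule.mem_top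
  obtain ⟨r, rfl⟩ := Submodule.mem_span_singleton.1 hy
  exact ⟨r.unop, rfl⟩

namespace LaurentSeries

open PowerSeries HahnSeries

variable {A : Type*} [Ring A]

theorem mul_mem_rightIdeal {B : Type*} [Ring B] (J : Submodule Bᵐᵒᵖ B) {f : B} (hf : f ∈ J)
    (g : B) : f * g ∈ J :=
  J.smul_mem (MulOpposite.op g) hf

/-- The right ideal of constant coefficients of the power series lying in a right ideal of the
Laurent series ring. -/
def constCoeffIdeal (J : Submodule (LaurentSeries A)ᵐᵒᵖ (LaurentSeries A)) :
    Submodule Aᵐᵒᵖ A where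
  carrier := {a | ∃ f : PowerSeries A, ofPowerSeries ℤ A f ∈ J ∧ constantCoeff f = a}
  zero_mem' := ⟨0, by simp, by simp⟩
  add_mem' := by
    rintro _ _ ⟨f, hf, rfl⟩ ⟨g, hg, rfl⟩
    exact ⟨f + g, by simpa using J.add_mem hf hg, by simp⟩
  smul_mem' := by
    rintro c _ ⟨f, hf, rfl⟩
    refine ⟨f * PowerSeries.C c.unop, ?_, by simp⟩
    rw [map_mul]
    exact mul_mem_rightIdeal J hf _

theorem constCoeffIdeal_mono : Monotone (constCoeffIdeal (A := A)) := by
  rintro J J' h _ ⟨f, hf, rfl⟩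
  exact ⟨f, h hf, rfl⟩

theorem eq_mul_single_of_X_mul (f : PowerSeries A) :
    ofPowerSeries ℤ A f = ofPowerSeries ℤ A (X * f) * HahnSeries.single (-1 : ℤ) (1 : A) := by
  rw [X_mul, map_mul, ofPowerSeries_X, mul_assoc, HahnSeries.single_mul_single]
  simp

/-- Division with remainder by a finite family of power series whose constant coefficients
generate the ideal of constant coefficients. -/
theorem exists_eq_sum_mul {J : Submodule (LaurentSeries A)ᵐᵒᵖ (LaurentSeries A)} {ι : Type*}
    [Fintype ι] (f : ι → PowerSeries A) (hf : ∀ i, ofPowerSeries ℤ A (f i) ∈ J)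
    (hspan : constCoeffIdeal J ≤ Submodule.span Aᵐᵒᵖ (Set.range fun i => constantCoeff (f i)))
    (g : PowerSeries A) (hg : ofPowerSeries ℤ A g ∈ J) :
    ∃ r : ι → PowerSeries A, g = ∑ i, f i * r i := by
  have step : ∀ g : {g : PowerSeries A // ofPowerSeries ℤ A g ∈ J},
      ∃ (c : ι → A) (g' : {g : PowerSeries A // ofPowerSeries ℤ A g ∈ J}),
        (g : PowerSeries A) = ∑ i, f i * PowerSeries.C (c i) + X * (g' : PowerSeries A) := by
    rintro ⟨g, hg⟩
    obtain ⟨c, hc⟩ := (Submodule.mem_span_range_iff_exists_fun _).1 (hspan ⟨g, hg, rfl⟩)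
    let d : PowerSeries A := g - ∑ i, f i * PowerSeries.C (c i).unop
    have hdJ : ofPowerSeries ℤ A d ∈ J := by
      simp only [d, map_sub, map_sum, map_mul]
      exact J.sub_mem hg (J.sum_mem fun i _ => mul_mem_rightIdeal J (hf i) _)
    have hd0 : coeff 0 d = 0 := by
      simp only [MulOpposite.smul_eq_mul_unop] at hc
      simp [d, hc]
    let g' : PowerSeries A := PowerSeries.mk fun n => coeff (n + 1) d
    have hd : d = X * g' := by
      ext n
      cases n with
      | zero => rw [hd0, coeff_zero_X_mul]
      | succ n => rw [coeff_succ_X_mul, coeff_mk]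
    refine ⟨fun i => (c i).unop, ⟨g', ?_⟩, ?_⟩
    · rw [eq_mul_single_of_X_mul, ← hd]
      exact mul_mem_rightIdeal J hdJ _
    · rw [← hd]
      simp [d]
  choose c next hnext using step
  let r : ι → {g : PowerSeries A // ofPowerSeries ℤ A g ∈ J} → PowerSeries A :=
    fun i g => PowerSeries.mk fun m => c (next^[m] g) i
  have hr : ∀ i g, r i g = PowerSeries.C (c g i) + X * r i (next g) := by
    intro i g
    ext n
    cases n with
    | zero => simp [r]
    | succ n => simp [r, coeff_succ_X_mul]
  let D : {g : PowerSeries A // ofPowerSeries ℤ A g ∈ J} → PowerSeries A :=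
    fun g => g - ∑ i, f i * r i g
  have hD : ∀ g, D g = X * D (next g) := by
    intro g
    have h1 : ∑ i, f i * r i g =
        ∑ i, f i * PowerSeries.C (c g i) + X * ∑ i, f i * r i (next g) := by
      rw [Finset.mul_sum, ← Finset.sum_add_distrib]
      refine Finset.sum_congr rfl fun i _ => ?_
      rw [hr i g, mul_add, ← mul_assoc, ← mul_assoc, X_mul]
    simp only [D]
    rw [h1, mul_sub]
    conv_lhs => rw [hnext g]
    abel
  have hcoeff : ∀ n g, coeff n (D g) = 0 := by
    intro n
    induction n with
    | zero => intro g; rw [hD, coeff_zero_X_mul]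
    | succ n ih => intro g; rw [hD, coeff_succ_X_mul, ih]
  refine ⟨fun i => r i ⟨g, hg⟩, sub_eq_zero.1 ?_⟩
  ext n
  simpa only [map_zero] using hcoeff n ⟨g, hg⟩

theorem le_of_constCoeffIdeal_le [IsNoetherian Aᵐᵒᵖ A]
    {J J' : Submodule (LaurentSeries A)ᵐᵒᵖ (LaurentSeries A)} (h : J ≤ J')
    (hc : constCoeffIdeal J' ≤ constCoeffIdeal J) : J' ≤ J := by
  obtain ⟨n, a, ha⟩ := Submodule.fg_iff_exists_fin_generating_family.1
    (IsNoetherian.noetherian (constCoeffIdeal J))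
  have hmem : ∀ i, a i ∈ constCoeffIdeal J := fun i =>
    ha ▸ Submodule.subset_span (Set.mem_range_self i)
  choose f hf hfa using hmem
  have hspan : constCoeffIdeal J' ≤
      Submodule.span Aᵐᵒᵖ (Set.range fun i => constantCoeff (f i)) := by
    simpa only [hfa, ha] using hc
  intro g hg
  have hpart := ofPowerSeries_powerSeriesPart g
  have hsingle : ∀ (k : ℤ) (φ : LaurentSeries A),
      HahnSeries.single k (1 : A) * φ = φ * HahnSeries.single k (1 : A) := by
    intro k φ
    ext m
    have hl := HahnSeries.coeff_single_mul_add (r := (1 : A)) (x := φ) (a := m - k) (b := k)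
    have hr := HahnSeries.coeff_mul_single_add (r := (1 : A)) (x := φ) (a := m - k) (b := k)
    simp only [sub_add_cancel, one_mul, mul_one] at hl hr
    rw [hl, hr]
  have hpJ : ofPowerSeries ℤ A (powerSeriesPart g) ∈ J' := by
    rw [hpart, hsingle]
    exact mul_mem_rightIdeal J' hg _
  obtain ⟨r, hr⟩ := exists_eq_sum_mul f (fun i => h (hf i)) hspan _ hpJ
  rw [← single_order_mul_powerSeriesPart g, hsingle]
  refine mul_mem_rightIdeal J ?_ _
  rw [hr, map_sum]
  refine J.sum_mem fun i _ => ?_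
  rw [map_mul]
  exact mul_mem_rightIdeal J (hf i) _

/-- Hilbert's basis theorem for Laurent series over a right Noetherian ring. -/
theorem isNoetherian_op [IsNoetherian Aᵐᵒᵖ A] :
    IsNoetherian (LaurentSeries A)ᵐᵒᵖ (LaurentSeries A) := by
  have hmono : StrictMono (constCoeffIdeal (A := A)) := fun J J' h =>
    lt_of_le_not_ge (constCoeffIdeal_mono h.le) fun hc =>
      h.not_ge (le_of_constCoeffIdeal_le h.le hc)
  rw [isNoetherian_iff']
  exact hmono.wellFoundedGT

/-- The Laurent series `f` such that, for every `g`, the coefficient of `f * g` at `(pair i n) ^ 2`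
lies in `I (pair i n)` for all large `n`. -/
def eventuallyMem (I : ℕ → Submodule Aᵐᵒᵖ A) (i : ℕ) :
    Submodule (LaurentSeries A)ᵐᵒᵖ (LaurentSeries A) where
  carrier := {f | ∀ g : LaurentSeries A, ∀ᶠ n in Filter.atTop,
    (f * g).coeff ((Nat.pair i n : ℤ) ^ 2) ∈ I (Nat.pair i n)}
  zero_mem' := fun g => by simp
  add_mem' := by
    intro f f' hf hf' g
    filter_upwards [hf g, hf' g] with n hn hn'
    rw [add_mul, HahnSeries.coeff_add]
    exact (I _).add_mem hn hn'
  smul_mem' := by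
    intro c f hf g
    have := hf (c.unop * g)
    rwa [← mul_assoc] at this

/-- The sparse Laurent series `∑ a (pair j n) x ^ (pair j n) ^ 2`. -/
noncomputable def sparseSeries (a : ℕ → A) (j : ℕ) : LaurentSeries A :=
  ofPowerSeries ℤ A (PowerSeries.mk fun m =>
    if m.sqrt ^ 2 = m ∧ m.sqrt.unpair.1 = j then a m.sqrt else 0)

theorem sparseSeries_coeff_pair (a : ℕ → A) (j n : ℕ) :
    (sparseSeries a j).coeff ((Nat.pair j n : ℤ) ^ 2) = a (Nat.pair j n) := by
  have h : ((Nat.pair j n : ℤ) ^ 2) = ((Nat.pair j n ^ 2 : ℕ) : ℤ) := by push_cast; rfl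
  rw [h, sparseSeries, ofPowerSeries_apply_coeff, coeff_mk]
  simp [Nat.sqrt_eq']

theorem sparseSeries_coeff_ne_zero {a : ℕ → A} {j : ℕ} {s : ℤ}
    (hs : (sparseSeries a j).coeff s ≠ 0) :
    ∃ l : ℕ, s = (l : ℤ) ^ 2 ∧ l.unpair.1 = j ∧ (sparseSeries a j).coeff s = a l := by
  have h0 : 0 ≤ s := by
    by_contra hneg
    apply hs
    rw [sparseSeries, PowerSeries.coeff_coe, if_pos (not_le.1 hneg)]
  lift s to ℕ using h0
  rw [sparseSeries, ofPowerSeries_apply_coeff, coeff_mk] at hs ⊢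
  split_ifs at hs ⊢ with h
  · exact ⟨s.sqrt, by exact_mod_cast h.1.symm, h.2, rfl⟩
  · exact absurd rfl hs

theorem sparseSeries_mem_eventuallyMem {I : ℕ → Submodule Aᵐᵒᵖ A} {a : ℕ → A}
    (hI : Monotone I) (ha : ∀ k, a k ∈ I (k + 1)) {i j : ℕ} (hij : j ≠ i) :
    sparseSeries a j ∈ eventuallyMem I i := by
  intro g
  filter_upwards [Filter.eventually_ge_atTop (-g.order).toNat] with n hn
  have hk : n ≤ Nat.pair i n := Nat.right_le_pair i n
  have hki : (Nat.pair i n).unpair.1 = i := by simp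
  generalize Nat.pair i n = k at hk hki ⊢
  rw [HahnSeries.coeff_mul]
  refine (I k).sum_mem fun st hst => ?_
  obtain ⟨hs, ht, hsum⟩ := Finset.mem_antidiagonal.1 hst
  obtain ⟨l, hl, hlj, hcoeff⟩ := sparseSeries_coeff_ne_zero hs
  have horder : g.order ≤ st.2 := HahnSeries.order_le_of_coeff_ne_zero ht
  have hlk : l ≠ k := fun h => hij (by rw [← hlj, h, hki])
  have hlt : l < k := by
    refine lt_of_le_of_ne ?_ hlk
    by_contra! hcon
    have h1 : (k : ℤ) + 1 ≤ l := by exact_mod_cast hcon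
    have h2 : -g.order ≤ k := by omega
    nlinarith
  rw [hcoeff]
  exact mul_mem_rightIdeal (I k) (hI hlt (ha l)) _

theorem sparseSeries_notMem_eventuallyMem {I : ℕ → Submodule Aᵐᵒᵖ A} {a : ℕ → A}
    (ha : ∀ k, a k ∉ I k) (i : ℕ) : sparseSeries a i ∉ eventuallyMem I i := by
  intro h
  obtain ⟨n, hn⟩ := (h 1).exists
  rw [mul_one, sparseSeries_coeff_pair] at hn
  exact ha _ hn

/-- If `A` is not right Noetherian, some cyclic right module over `A((x))` contains an infinite
direct sum of nonzero submodules. -/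
theorem exists_quotient_not_isFinDimModule (h : ¬ IsNoetherian Aᵐᵒᵖ A) :
    ∃ J : Submodule (LaurentSeries A)ᵐᵒᵖ (LaurentSeries A),
      ¬ IsFinDimModule (LaurentSeries A)ᵐᵒᵖ (LaurentSeries A ⧸ J) := by
  obtain ⟨I, a, hI, ha⟩ := exists_seq_notMem_of_not_isNoetherian h
  obtain ⟨J, hne, hind⟩ := exists_quotient_iSupIndep
    (fun i => Submodule.span (LaurentSeries A)ᵐᵒᵖ {sparseSeries a i}) (fun i hle =>
      sparseSeries_notMem_eventuallyMem (fun k => (ha k).2) i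
        ((hle.trans (iSup₂_le fun j hj => (Submodule.span_singleton_le_iff_mem _ _).2
          (sparseSeries_mem_eventuallyMem hI (fun k => (ha k).1) hj)))
          (Submodule.mem_span_singleton_self _)))
  exact ⟨J, not_not.2 ⟨ℕ, inferInstance, _, hne, hind⟩⟩

theorem span_mkQ_one_eq_top {B : Type*} [Ring B] (J : Submodule Bᵐᵒᵖ B) :
    Submodule.span Bᵐᵒᵖ {J.mkQ 1} = ⊤ := by
  rw [eq_top_iff]
  intro y _
  obtain ⟨b, rfl⟩ := J.mkQ_surjective y
  refine Submodule.mem_span_singleton.2 ⟨MulOpposite.op b, ?_⟩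
  rw [← map_smul]
  simp

end LaurentSeries

theorem IsNoetherian.isFinDimModule {R M : Type*} [Ring R] [AddCommGroup M] [Module R M]
    [IsNoetherian R M] : IsFinDimModule R M := by
  rintro ⟨ι, hι, N, hN, hind⟩
  have hfin := Submodule.finite_ne_bot_of_iSupIndep hind
  simp only [hN, ne_eq, not_false_eq_true, Set.ofPred_true] at hfin
  exact Set.infinite_univ hfin

/-- For the Laurent series ring `R = A((x))`, every cyclic right `R`-module is
finite-dimensional if and only if `R` is right Noetherian, if and only if `A`
is right Noetherian. -/
theorem laurentSeries_cyclic_finDim_tfae (A : Type u) [Ring A] :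
    List.TFAE
      [∀ (M : Type u) [AddCommGroup M] [Module (LaurentSeries A)ᵐᵒᵖ M],
         (∃ m : M, Submodule.span (LaurentSeries A)ᵐᵒᵖ {m} = ⊤) →
           IsFinDimModule (LaurentSeries A)ᵐᵒᵖ M,
       IsNoetherian (LaurentSeries A)ᵐᵒᵖ (LaurentSeries A),
       IsNoetherian Aᵐᵒᵖ A] := by
  tfae_have 2 → 1 := by
    rintro h M _ _ ⟨m, hm⟩
    have := isNoetherian_of_span_singleton_eq_top hm
    exact IsNoetherian.isFinDimModule
  tfae_have 1 → 3 := by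
    intro h
    by_contra hA
    obtain ⟨J, hJ⟩ := LaurentSeries.exists_quotient_not_isFinDimModule hA
    exact hJ (h _ ⟨_, LaurentSeries.span_mkQ_one_eq_top J⟩)
  tfae_have 3 → 2 := fun h => LaurentSeries.isNoetherian_op
  tfae_finish
end

section
/- Let A be a (not necessarily commutative) ring. The Laurent series ring A((x)) is a right serial ring satisfying the maximum condition on right annihilators (the ascending chain condition on right annihilator ideals) if and only if A is a right serial right Artinian ring. -/
/-- `I` is a *right annihilator* in the ring `R` if `I` is the set of elements
annihilated on the left by some subset `S` of `R`. -/
def IsRightAnnihilator (R : Type*) [Ring R] (I : Submodule Rᵐᵒᵖ R) : Prop :=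
  ∃ S : Set R, (I : Set R) = {x : R | ∀ s ∈ S, s * x = 0}

/-- A ring `R` satisfies the *maximum condition on right annihilators* if there
is no strictly increasing infinite chain of right annihilators in `R`. -/
def HasMaxConditionOnRightAnnihilators (R : Type*) [Ring R] : Prop :=
  ¬ ∃ f : ℕ → Submodule Rᵐᵒᵖ R, (∀ n, IsRightAnnihilator R (f n)) ∧ StrictMono f

open Submodule in
theorem isUniserialModule_coe_iff {R M : Type*} [Ring R] [AddCommGroup M] [Module R M]
    {N : Submodule R M} :
    IsUniserialModule R N ↔ ∀ P ≤ N, ∀ Q ≤ N, P ≤ Q ∨ Q ≤ P := by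
  constructor
  · intro h P hP Q hQ
    rcases h (P.comap N.subtype) (Q.comap N.subtype) with h | h
    · exact Or.inl fun x hx => h (show (⟨x, hP hx⟩ : N) ∈ P.comap N.subtype from hx)
    · exact Or.inr fun x hx => h (show (⟨x, hQ hx⟩ : N) ∈ Q.comap N.subtype from hx)
  · intro h P Q
    have key := h (P.map N.subtype) (map_subtype_le _ _) (Q.map N.subtype) (map_subtype_le _ _)
    rwa [map_le_map_iff_of_injective N.injective_subtype,
      map_le_map_iff_of_injective N.injective_subtype] at key

open Submodule in
theorem isUniserialModule_coe_iff_mem_span {R M : Type*} [Ring R] [AddCommGroup M] [Module R M]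
    {N : Submodule R M} :
    IsUniserialModule R N ↔ ∀ a ∈ N, ∀ b ∈ N, a ∈ R ∙ b ∨ b ∈ R ∙ a := by
  rw [isUniserialModule_coe_iff]
  constructor
  · intro h a ha b hb
    simpa using h (R ∙ a) (by simpa) (R ∙ b) (by simpa)
  · intro h P hP Q hQ
    by_contra! hc
    obtain ⟨h1, h2⟩ := hc
    obtain ⟨a, haP, haQ⟩ := SetLike.not_le_iff_exists.1 h1
    obtain ⟨b, hbQ, hbP⟩ := SetLike.not_le_iff_exists.1 h2
    rcases h a (hP haP) b (hQ hbQ) with h | h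
    · exact haQ ((span_singleton_le_iff_mem _ _).2 hbQ h)
    · exact hbP ((span_singleton_le_iff_mem _ _).2 haP h)

open Submodule in
theorem IsUniserialModule.exists_forall_mem_span {R M κ : Type*} [Ring R] [AddCommGroup M]
    [Module R M] {N : Submodule R M} (hN : IsUniserialModule R N) {T : Finset κ}
    (hT : T.Nonempty) {u : κ → M} (hu : ∀ t ∈ T, u t ∈ N) :
    ∃ t ∈ T, ∀ s ∈ T, u s ∈ R ∙ u t := by
  classical
  rw [isUniserialModule_coe_iff_mem_span] at hN
  induction hT using Finset.Nonempty.cons_induction with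
  | singleton a => exact ⟨a, by simp, by simp [mem_span_singleton_self]⟩
  | cons a T ha hT ih =>
    obtain ⟨t, ht, hmax⟩ := ih fun s hs => hu s (by simp [hs])
    rcases hN _ (hu a (by simp)) _ (hu t (by simp [ht])) with h | h
    · refine ⟨t, by simp [ht], fun s hs => ?_⟩
      rcases Finset.mem_cons.1 hs with rfl | hs
      · exact h
      · exact hmax s hs
    · refine ⟨a, by simp, fun s hs => ?_⟩
      rcases Finset.mem_cons.1 hs with rfl | hs
      · exact mem_span_singleton_self _
      · exact (span_singleton_le_iff_mem _ _).2 h (hmax s hs)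

open Submodule in
/-- Among more than `n` elements of a sum of `n` uniserial submodules, one is a linear combination
of the others. -/
theorem exists_mem_span_erase_of_card_lt {R M ι κ : Type*} [Ring R] [AddCommGroup M] [Module R M]
    [DecidableEq κ] {U : ι → Submodule R M} (hU : ∀ i, IsUniserialModule R (U i)) (S : Finset ι)
    {T : Finset κ} (hST : S.card < T.card) {g : κ → M} (hg : ∀ t ∈ T, g t ∈ S.sup U) :
    ∃ t ∈ T, g t ∈ span R (g '' (T.erase t)) := by
  classical
  induction S using Finset.induction_on generalizing T g with
  | empty =>
    obtain ⟨t, ht⟩ := Finset.card_pos.1 (by simpa using hST)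
    have : g t = 0 := by simpa using hg t ht
    exact ⟨t, ht, this ▸ zero_mem _⟩
  | insert i S hi ih =>
    have hdec : ∀ t, ∃ u w, t ∈ T → u ∈ U i ∧ w ∈ S.sup U ∧ u + w = g t := by
      intro t
      by_cases ht : t ∈ T
      · have := hg t ht
        rw [Finset.sup_insert, mem_sup] at this
        obtain ⟨u, hu, w, hw, h⟩ := this
        exact ⟨u, w, fun _ => ⟨hu, hw, h⟩⟩
      · exact ⟨0, 0, fun h => absurd h ht⟩
    choose u w huw using hdec
    rw [Finset.card_insert_of_notMem hi] at hST
    obtain ⟨t₀, ht₀, hmax⟩ := (hU i).exists_forall_mem_span (u := u)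
      (Finset.card_pos.1 (Nat.zero_lt_of_lt hST)) fun t ht => (huw t ht).1
    have : ∀ s, ∃ r : R, s ∈ T → r • u t₀ = u s := by
      intro s
      by_cases hs : s ∈ T
      · obtain ⟨r, hr⟩ := mem_span_singleton.1 (hmax s hs)
        exact ⟨r, fun _ => hr⟩
      · exact ⟨0, fun h => absurd h hs⟩
    choose r hr using this
    obtain ⟨t, ht, hmem⟩ := ih (T := T.erase t₀) (g := fun s => g s - r s • g t₀)
      (by rw [Finset.card_erase_of_mem ht₀]; omega) (by
        intro s hs
        have hs := Finset.mem_of_mem_erase hs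
        rw [← (huw s hs).2.2, ← (huw t₀ ht₀).2.2, smul_add, hr s hs, add_sub_add_left_eq_sub]
        exact sub_mem (huw s hs).2.1 (smul_mem _ _ (huw t₀ ht₀).2.1))
    obtain ⟨hne, htT⟩ := Finset.mem_erase.1 ht
    refine ⟨t, htT, ?_⟩
    have hle : span R ((fun s => g s - r s • g t₀) '' ((T.erase t₀).erase t)) ≤
        span R (g '' (T.erase t)) := by
      rw [span_le]
      rintro _ ⟨s, hs, rfl⟩
      have hs' := Finset.mem_coe.1 hs
      simp only [Finset.mem_erase] at hs'
      exact sub_mem (subset_span ⟨s, by simp [hs'.1, hs'.2.2], rfl⟩)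
        (smul_mem _ _ (subset_span ⟨t₀, by simp [hne.symm, ht₀], rfl⟩))
    have h1 := hle hmem
    have h2 : g t₀ ∈ span R (g '' (T.erase t)) :=
      subset_span ⟨t₀, by simp [hne.symm, ht₀], rfl⟩
    simpa using add_mem h1 (smul_mem _ (r t) h2)

/-- **Levitzki's theorem**: a nil two-sided ideal of a left Noetherian ring is nilpotent. -/
theorem Ideal.isNilpotent_of_forall_mem_isNilpotent {R : Type*} [Ring R] [IsNoetherianRing R]
    (I : Ideal R) [I.IsTwoSided] (hI : ∀ a ∈ I, IsNilpotent a) : IsNilpotent I := by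
  obtain ⟨N, ⟨hN2, n, hn⟩, hNmax⟩ := WellFounded.has_min (wellFounded_gt (α := Ideal R))
    {N | N.IsTwoSided ∧ IsNilpotent N}
    ⟨⊥, inferInstance, 1, by rw [Submodule.pow_one]; rfl⟩
  suffices h : I ≤ N by
    refine ⟨n, le_bot_iff.1 ?_⟩
    have : ∀ m, I ^ m ≤ N ^ m := by
      intro m
      induction m with
      | zero => simp [Submodule.pow_zero]
      | succ m ih =>
        rw [Ideal.IsTwoSided.pow_succ, Ideal.IsTwoSided.pow_succ]
        exact Ideal.mul_mono h ih
    exact (this n).trans hn.le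
  by_contra hIN
  obtain ⟨a₀, ha₀, ha₀N⟩ := SetLike.not_le_iff_exists.1 hIN
  let ann (a : R) : Ideal R := Submodule.comap (LinearMap.toSpanSingleton R R a) N
  have hann : ∀ a t, t ∈ ann a ↔ t * a ∈ N := fun a t => Iff.rfl
  obtain ⟨_, ⟨a, haI, haN, rfl⟩, hamax⟩ := WellFounded.has_min (wellFounded_gt (α := Ideal R))
    {L | ∃ a ∈ I, a ∉ N ∧ ann a = L} ⟨_, a₀, ha₀, ha₀N, rfl⟩
  have key : ∀ s, a * s * a ∈ N := by
    intro s
    have hnil : ∃ k, (a * s) ^ k ∈ N := by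
      obtain ⟨k, hk⟩ := hI (a * s) (I.mul_mem_right s haI)
      exact ⟨k, hk ▸ N.zero_mem⟩
    classical
    have hk := Nat.find_spec hnil
    have hkmin := fun m => Nat.find_min (H := hnil) (m := m)
    obtain hk' | ⟨m, hm⟩ : Nat.find hnil ≤ 1 ∨ ∃ m, Nat.find hnil = m + 2 := by
      rcases Nat.lt_or_ge 1 (Nat.find hnil) with h | h
      · exact Or.inr ⟨_, (Nat.sub_add_cancel h).symm⟩
      · exact Or.inl h
    · apply N.mul_mem_right
      have : (a * s) ^ 1 ∈ N := by
        rw [← Nat.sub_add_cancel hk', pow_add]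
        exact N.mul_mem_left _ hk
      simpa using this
    · have hb : (a * s) ^ (m + 1) ∉ N := hkmin _ (by omega)
      rw [hm] at hk
      have hle : ann a ≤ ann ((a * s) ^ (m + 1)) := by
        intro t ht
        rw [hann] at ht ⊢
        rw [pow_succ', ← mul_assoc, ← mul_assoc]
        exact N.mul_mem_right _ (N.mul_mem_right _ ht)
      have heq : ann a = ann ((a * s) ^ (m + 1)) := by
        refine eq_of_le_of_not_lt hle (hamax _ ⟨_, ?_, hb, rfl⟩)
        rw [pow_succ', mul_assoc]
        exact I.mul_mem_right _ haI
      rw [← hann, heq, hann, ← pow_succ']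
      exact hk
  let K : Ideal R := N ⊔ Ideal.span (Set.range fun r => a * r)
  have hK2 : K.IsTwoSided := by
    refine ⟨fun {x} b hx => ?_⟩
    obtain ⟨y, hy, z, hz, rfl⟩ := Submodule.mem_sup.1 hx
    clear hx
    rw [add_mul]
    refine Submodule.add_mem_sup (N.mul_mem_right _ hy) ?_
    induction hz using Submodule.span_induction with
    | mem z hz => obtain ⟨r, rfl⟩ := hz; exact Ideal.subset_span ⟨r * b, by simp [mul_assoc]⟩
    | zero => simp
    | add x y _ _ h1 h2 => rw [add_mul]; exact add_mem h1 h2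
    | smul c x _ h => rw [smul_mul_assoc]; exact Submodule.smul_mem _ _ h
  have hKK : K * K ≤ N := by
    rw [Ideal.mul_le]
    intro x hx y hy
    obtain ⟨x, hxN, x', hx', rfl⟩ := Submodule.mem_sup.1 hx
    obtain ⟨y, hyN, y', hy', rfl⟩ := Submodule.mem_sup.1 hy
    clear hx hy
    rw [add_mul, mul_add x']
    refine N.add_mem (N.mul_mem_right _ hxN) (N.add_mem (N.mul_mem_left _ hyN) ?_)
    clear hxN hyN x y
    induction hx' using Submodule.span_induction with
    | mem x hx =>
      obtain ⟨r, rfl⟩ := hx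
      have : ∀ r, a * r * y' ∈ N := by
        induction hy' using Submodule.span_induction with
        | mem y hy =>
          obtain ⟨s, rfl⟩ := hy
          intro r
          simp only [← mul_assoc]
          exact N.mul_mem_right _ (key r)
        | zero => simp
        | add x y _ _ h1 h2 => intro r; rw [mul_add]; exact add_mem (h1 r) (h2 r)
        | smul c x _ h => intro r; rw [smul_eq_mul, ← mul_assoc, mul_assoc a]; exact h _
      exact this r
    | zero => simp
    | add x y _ _ h1 h2 => rw [add_mul]; exact add_mem h1 h2
    | smul c x _ h => rw [smul_mul_assoc]; exact Submodule.smul_mem _ _ h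
  have hKnil : IsNilpotent K := by
    have : ∀ m, K ^ (2 * m) ≤ N ^ m := by
      intro m
      induction m with
      | zero => simp [Submodule.pow_zero]
      | succ m ih =>
        rw [mul_add, mul_one, add_comm, Ideal.IsTwoSided.pow_add, Ideal.IsTwoSided.pow_succ (I := N)]
        refine Ideal.mul_mono ?_ ih
        rwa [Ideal.IsTwoSided.pow_succ, Submodule.pow_one]
    exact ⟨2 * n, le_bot_iff.1 ((this n).trans hn.le)⟩
  have haK : a ∈ K := (le_sup_right : _ ≤ K) (Ideal.subset_span ⟨1, mul_one a⟩)
  exact hNmax K ⟨hK2, hKnil⟩ (lt_of_le_of_ne le_sup_left fun h => haN (h ▸ haK))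

theorem Ideal.le_ringJacobson_of_forall_isNilpotent {R : Type*} [Ring R] {I : Ideal R}
    (hI : ∀ a ∈ I, IsNilpotent a) : I ≤ Ring.jacobson R := by
  intro x hx
  rw [← Ideal.jacobson_bot, Ideal.mem_jacobson_iff]
  intro y
  obtain ⟨u, hu⟩ := (hI (y * x) (I.mul_mem_left y hx)).isUnit_one_add
  refine ⟨↑u⁻¹, ?_⟩
  have : (↑u⁻¹ : R) * (1 + y * x) = 1 := by rw [← hu]; simp
  rw [Ideal.mem_bot, ← this]
  noncomm_ring

/-- A ring is left `π`-regular if every descending chain `R c ⊇ R c² ⊇ R c³ ⊇ …` stabilizes. -/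
def IsLeftPiRegular (R : Type*) [Ring R] : Prop :=
  ∀ c : R, ∃ (k : ℕ) (h : R), c ^ k = h * c ^ (k + 1)

namespace IsLeftPiRegular

variable {R : Type*} [Ring R]

theorem of_surjective (hR : IsLeftPiRegular R) {S : Type*} [Ring S] (f : R →+* S)
    (hf : Function.Surjective f) : IsLeftPiRegular S := by
  intro c
  obtain ⟨c, rfl⟩ := hf c
  obtain ⟨k, h, hk⟩ := hR c
  exact ⟨k, f h, by rw [← map_pow, hk, map_mul, map_pow]⟩

theorem isNilpotent_of_mem_jacobson (hR : IsLeftPiRegular R) {c : R} (hc : c ∈ Ring.jacobson R) :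
    IsNilpotent c := by
  obtain ⟨k, h, hk⟩ := hR c
  rw [← Ideal.jacobson_bot, Ideal.mem_jacobson_iff] at hc
  obtain ⟨z, hz⟩ := hc (-h)
  refine ⟨k, ?_⟩
  rw [Ideal.mem_bot] at hz
  have h1 : z * (1 - h * c) = 1 := by
    rw [← sub_eq_zero, ← hz]
    noncomm_ring
  calc c ^ k = z * (1 - h * c) * c ^ k := by rw [h1, one_mul]
    _ = z * (c ^ k - h * c ^ (k + 1)) := by rw [pow_succ' c k]; noncomm_ring
    _ = 0 := by rw [← hk, sub_self, mul_zero]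

theorem exists_isIdempotentElem [IsNoetherianRing R] (hR : IsLeftPiRegular R) {c : R}
    (hc : ¬ IsNilpotent c) : ∃ r : R, IsIdempotentElem (r * c) ∧ r * c ≠ 0 := by
  obtain ⟨k, h, hk⟩ := hR c
  have hpow : ∀ j m, k ≤ m → c ^ m = h ^ j * c ^ (m + j) := by
    intro j m hm
    induction j with
    | zero => simp
    | succ j ih =>
      obtain ⟨i, hi⟩ := Nat.exists_eq_add_of_le (hm.trans (Nat.le_add_right m j))
      calc c ^ m = h ^ j * (c ^ k * c ^ i) := by rw [ih, hi, pow_add]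
        _ = h ^ (j + 1) * (c ^ (k + 1) * c ^ i) := by rw [hk, pow_succ h j]; noncomm_ring
        _ = h ^ (j + 1) * c ^ (m + (j + 1)) := by
          rw [← pow_add, show m + (j + 1) = k + 1 + i by omega]
  obtain ⟨n, hn⟩ := monotone_stabilizes_iff_noetherian.2 ‹IsNoetherianRing R›
    ⟨fun n => LinearMap.ker (LinearMap.toSpanSingleton R R (c ^ n)), monotone_nat_of_le_succ
      fun n t ht => by
        have ht : t * c ^ n = 0 := ht
        change t * c ^ (n + 1) = 0
        rw [pow_succ, ← mul_assoc, ht, zero_mul]⟩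
  have hker : ∀ m, n ≤ m → ∀ t, t * c ^ m = 0 → t * c ^ n = 0 := by
    intro m hm t ht
    have : t ∈ LinearMap.ker (LinearMap.toSpanSingleton R R (c ^ n)) := by
      rw [show LinearMap.ker (LinearMap.toSpanSingleton R R (c ^ n)) = _ from hn m hm]
      exact ht
    exact this
  set m := n + k + 1 with hm
  set d := c ^ m with hd
  set g := h ^ m
  have hgd : g * (d * d) = d := by
    rw [hd, ← pow_add]
    exact (hpow m m (by omega)).symm
  have hidem : (g * d * g - g) * d = 0 := by
    have h2 : (g * d * g - g) * c ^ n = 0 := by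
      refine hker (m + m) (by omega) _ ?_
      rw [pow_add, ← hd]
      calc (g * d * g - g) * (d * d) = g * d * (g * (d * d)) - g * (d * d) := by noncomm_ring
        _ = 0 := by rw [hgd, mul_assoc, hgd, sub_self]
    rw [show d = c ^ n * c ^ (k + 1) by rw [← pow_add, ← add_assoc], ← mul_assoc,
      ← show d = c ^ n * c ^ (k + 1) by rw [← pow_add, ← add_assoc], h2, zero_mul]
  refine ⟨g * c ^ (n + k), ?_, ?_⟩
  · rw [mul_assoc, ← pow_succ, ← hm, ← hd, IsIdempotentElem, ← sub_eq_zero, ← hidem]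
    noncomm_ring
  · rw [mul_assoc, ← pow_succ, ← hm, ← hd]
    intro h0
    apply hc
    refine ⟨m, ?_⟩
    rw [← hd, ← hgd, ← mul_assoc, h0, zero_mul]

theorem exists_isIdempotentElem_mem [IsNoetherianRing R] (hR : IsLeftPiRegular R) {I : Ideal R}
    (hI : ¬ I ≤ Ring.jacobson R) : ∃ e ∈ I, IsIdempotentElem e ∧ e ≠ 0 := by
  by_contra! h
  refine hI (Ideal.le_ringJacobson_of_forall_isNilpotent fun c hc => ?_)
  by_contra hnil
  obtain ⟨r, hr, h0⟩ := hR.exists_isIdempotentElem hnil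
  exact h0 (h _ (I.mul_mem_left r hc) hr)

theorem _root_.IsIdempotentElem.isCompl_span {e : R} (he : IsIdempotentElem e) :
    IsCompl (Ideal.span {e}) (Ideal.span {1 - e}) := by
  refine ⟨Submodule.disjoint_def.2 fun x hx hy => ?_, codisjoint_iff.2 ?_⟩
  · obtain ⟨a, rfl⟩ := Ideal.mem_span_singleton'.1 hx
    obtain ⟨b, hb⟩ := Ideal.mem_span_singleton'.1 hy
    rw [← he.eq, ← mul_assoc, ← hb, mul_assoc, sub_mul, one_mul, he.eq, sub_self, mul_zero]
  · rw [Ideal.eq_top_iff_one]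
    have := Submodule.add_mem_sup (Ideal.mem_span_singleton_self e)
      (Ideal.mem_span_singleton_self (1 - e))
    rwa [add_sub_cancel] at this

theorem isSemisimpleRing [IsNoetherianRing R] (hR : IsLeftPiRegular R)
    (hJ : Ring.jacobson R = ⊥) : IsSemisimpleRing R := by
  suffices ComplementedLattice (Ideal R) from { __ := this }
  refine ⟨fun I => ?_⟩
  obtain ⟨_, ⟨e, heI, he, rfl⟩, hmax⟩ := WellFounded.has_min (wellFounded_gt (α := Ideal R))
    {L | ∃ e ∈ I, IsIdempotentElem e ∧ Ideal.span {e} = L} ⟨_, 0, I.zero_mem, .zero, rfl⟩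
  suffices I = Ideal.span {e} from ⟨Ideal.span {1 - e}, this ▸ he.isCompl_span⟩
  by_contra hne
  obtain ⟨a, haI, hae⟩ := SetLike.not_le_iff_exists.1 fun h =>
    hne (le_antisymm h ((Ideal.span_singleton_le_iff_mem _).2 heI))
  have hnot : ¬ I ⊓ Ideal.span {1 - e} ≤ Ring.jacobson R := by
    rw [hJ, le_bot_iff]
    intro h0
    have : a * (1 - e) ∈ I ⊓ Ideal.span {1 - e} :=
      ⟨by rw [mul_sub, mul_one]; exact I.sub_mem haI (I.mul_mem_left a heI),
        Ideal.mem_span_singleton'.2 ⟨a, rfl⟩⟩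
    rw [h0, Submodule.mem_bot, mul_sub, mul_one, sub_eq_zero] at this
    exact hae (Ideal.mem_span_singleton'.2 ⟨a, this.symm⟩)
  obtain ⟨f, ⟨hfI, hfe⟩, hf, hf0⟩ := hR.exists_isIdempotentElem_mem hnot
  obtain ⟨b, hb⟩ := Ideal.mem_span_singleton'.1 hfe
  have hfe : f * e = 0 := by rw [← hb, mul_assoc, sub_mul, one_mul, he.eq, sub_self, mul_zero]
  set e' := e + (1 - e) * f with he'
  have h1 : e' * e = e := by rw [he', add_mul, mul_assoc, hfe, mul_zero, add_zero, he.eq]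
  have h2 : e * e' = e := by
    rw [he', mul_add, ← mul_assoc, mul_sub, mul_one, he.eq, sub_self, zero_mul, add_zero]
  have h3 : f * e' = f := by
    rw [he', mul_add, hfe, zero_add, ← mul_assoc, mul_sub, hfe, mul_one, sub_zero, hf.eq]
  have hidem : IsIdempotentElem e' := by
    rw [IsIdempotentElem]
    nth_rw 1 [he']
    rw [add_mul, h2, mul_assoc, h3]
  refine hmax _ ⟨e', I.add_mem heI (I.mul_mem_left _ hfI), hidem, rfl⟩ (lt_of_le_of_ne ?_ ?_)
  · rw [Ideal.span_singleton_le_iff_mem]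
    exact Ideal.mem_span_singleton'.2 ⟨e, h2⟩
  · intro heq
    have : e' ∈ Ideal.span {e} := heq ▸ Ideal.mem_span_singleton_self e'
    obtain ⟨c, hc⟩ := Ideal.mem_span_singleton'.1 this
    have h4 : e' = e := by rw [← h1, ← hc, mul_assoc, he.eq]
    apply hf0
    rw [← h3, h4, hfe]

theorem isArtinianRing [IsNoetherianRing R] (hR : IsLeftPiRegular R) : IsArtinianRing R := by
  have hnil : IsNilpotent (Ring.jacobson R) :=
    Ideal.isNilpotent_of_forall_mem_isNilpotent _ fun a ha => hR.isNilpotent_of_mem_jacobson ha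
  have : IsNoetherianRing (R ⧸ Ring.jacobson R) :=
    isNoetherianRing_of_surjective _ _ (Ideal.Quotient.mk _) Ideal.Quotient.mk_surjective
  have hss : IsSemisimpleRing (R ⧸ Ring.jacobson R) :=
    (hR.of_surjective (Ideal.Quotient.mk _) Ideal.Quotient.mk_surjective).isSemisimpleRing
      (Ring.jacobson_quotient_jacobson R)
  have : IsSemiprimaryRing R := ⟨hss, hnil⟩
  exact IsSemiprimaryRing.isNoetherian_iff_isArtinian.1 ‹_›

end IsLeftPiRegular

/-- An element of a bounded lattice is indecomposable if it is not a nontrivial direct sum. -/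
def IsLatticeIndecomposable {α : Type*} [Lattice α] [OrderBot α] (a : α) : Prop :=
  a ≠ ⊥ ∧ ∀ b c, Disjoint b c → b ⊔ c = a → b = ⊥ ∨ c = ⊥

theorem exists_supIndep_indecomposable {α : Type*} [Lattice α] [IsModularLattice α] [OrderBot α]
    [WellFoundedLT α] (a : α) :
    ∃ S : Finset α, S.SupIndep id ∧ S.sup id = a ∧ ∀ b ∈ S, IsLatticeIndecomposable b := by
  classical
  induction a using WellFoundedLT.induction with
  | ind a ih =>
    by_cases h0 : a = ⊥
    · exact ⟨∅, Finset.supIndep_empty _, by simp [h0], by simp⟩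
    by_cases ha : IsLatticeIndecomposable a
    · exact ⟨{a}, Finset.supIndep_singleton _ _, by simp, by simpa⟩
    · simp only [IsLatticeIndecomposable] at ha
      push Not at ha
      obtain ⟨b, c, hbc, rfl, hb, hc⟩ := ha h0
      obtain ⟨S, hS, rfl, hS'⟩ := ih b (left_lt_sup.2 fun h => hc (hbc.eq_bot_of_ge h))
      obtain ⟨T, hT, rfl, hT'⟩ := ih c (right_lt_sup.2 fun h => hb (hbc.eq_bot_of_le h))
      refine ⟨S ∪ T, hS.union hT hbc, Finset.sup_union, fun b hb => ?_⟩
      rcases Finset.mem_union.1 hb with hb | hb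
      exacts [hS' b hb, hT' b hb]

/-- Proper subideals of an indecomposable left ideal are contained in the Jacobson radical. -/
theorem IsLatticeIndecomposable.eq_or_le_jacobson {R : Type*} [Ring R] [IsNoetherianRing R]
    (hR : IsLeftPiRegular R) {M I : Ideal R} (hM : IsLatticeIndecomposable M) (hI : I ≤ M) :
    I = M ∨ I ≤ Ring.jacobson R := by
  refine or_iff_not_imp_right.2 fun hJ => ?_
  obtain ⟨e, heI, he, he0⟩ := hR.exists_isIdempotentElem_mem hJ
  have hle : Ideal.span {e} ≤ I := (Ideal.span_singleton_le_iff_mem _).2 heI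
  rcases hM.2 (Ideal.span {e}) (Ideal.span {1 - e} ⊓ M)
    (he.isCompl_span.disjoint.mono_right inf_le_left)
    (by rw [← sup_inf_assoc_of_le _ (hle.trans hI), he.isCompl_span.sup_eq_top, top_inf_eq])
    with h | h
  · exact absurd (Ideal.span_singleton_eq_bot.1 h) he0
  · refine le_antisymm hI (le_trans ?_ hle)
    have := he.isCompl_span.sup_eq_top
    calc M = (Ideal.span {e} ⊔ Ideal.span {1 - e}) ⊓ M := by rw [this, top_inf_eq]
      _ = Ideal.span {e} := by rw [sup_inf_assoc_of_le _ (hle.trans hI), h, sup_bot_eq]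
      _ ≤ _ := le_rfl

namespace LaurentSeries

variable {B : Type*} [Ring B]

theorem coeff_mul_mem (I : AddSubmonoid B) {f g : LaurentSeries B} {n : ℤ}
    (h : ∀ i j, i + j = n → f.coeff i ≠ 0 → g.coeff j ≠ 0 → f.coeff i * g.coeff j ∈ I) :
    (f * g).coeff n ∈ I := by
  rw [HahnSeries.coeff_mul]
  refine sum_mem fun ij hij => ?_
  rw [Finset.mem_antidiagonal] at hij
  exact h _ _ hij.2.2 hij.1 hij.2.1

/-- The left ideal of Laurent series with coefficients in a given left ideal. -/
def coeffIdeal (I : Ideal B) : Ideal (LaurentSeries B) where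
  carrier := {f | ∀ n, f.coeff n ∈ I}
  add_mem' hf hg n := I.add_mem (hf n) (hg n)
  zero_mem' _ := I.zero_mem
  smul_mem' _ _ hg _ := coeff_mul_mem I.toAddSubmonoid fun _ j _ _ _ => I.mul_mem_left _ (hg j)

theorem mem_coeffIdeal {I : Ideal B} {f : LaurentSeries B} :
    f ∈ coeffIdeal I ↔ ∀ n, f.coeff n ∈ I := Iff.rfl

theorem coeffIdeal_mono {I J : Ideal B} (h : I ≤ J) : coeffIdeal I ≤ coeffIdeal J :=
  fun _ hf n => h (hf n)

theorem C_mem_coeffIdeal {I : Ideal B} {b : B} (hb : b ∈ I) : HahnSeries.C b ∈ coeffIdeal I := by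
  intro n
  rw [HahnSeries.C_apply, HahnSeries.coeff_single]
  split_ifs
  exacts [hb, I.zero_mem]

theorem coeff_mul_C (f : LaurentSeries B) (b : B) (n : ℤ) :
    (f * HahnSeries.C b).coeff n = f.coeff n * b :=
  HahnSeries.coeff_mul_single_zero

/-- The Laurent series with coefficients `a 0, a 1, a 2, …` at the squares `0, 1, 4, …`, keeping
only the coefficients `a q` such that `p q` holds. -/
noncomputable def squareSeries (a : ℕ → B) (p : ℕ → Prop) [DecidablePred p] : LaurentSeries B :=
  HahnSeries.ofSuppBddBelow
    (fun j => if ((j.toNat.sqrt : ℤ)) ^ 2 = j ∧ p j.toNat.sqrt then a j.toNat.sqrt else 0) <| show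
      BddBelow _ by
      refine ⟨0, fun j hj => ?_⟩
      have : ((j.toNat.sqrt : ℤ)) ^ 2 = j ∧ p j.toNat.sqrt := by
        by_contra h
        exact hj (if_neg h)
      rw [← this.1]
      positivity

theorem coeff_squareSeries (a : ℕ → B) (p : ℕ → Prop) [DecidablePred p] (q : ℕ) :
    (squareSeries a p).coeff ((q : ℤ) ^ 2) = if p q then a q else 0 := by
  have : ((q : ℤ) ^ 2).toNat.sqrt = q := by
    rw [← Nat.cast_pow, Int.toNat_natCast, Nat.sqrt_eq']
  change (if _ then _ else _) = _
  simp [this]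

theorem exists_of_coeff_squareSeries_ne_zero {a : ℕ → B} {p : ℕ → Prop} [DecidablePred p] {j : ℤ}
    (h : (squareSeries a p).coeff j ≠ 0) :
    ∃ q : ℕ, p q ∧ j = (q : ℤ) ^ 2 ∧ (squareSeries a p).coeff j = a q := by
  have : ((j.toNat.sqrt : ℤ)) ^ 2 = j ∧ p j.toNat.sqrt := by
    by_contra h'
    exact h (if_neg h')
  exact ⟨_, this.2, this.1.symm, if_pos this⟩

/-- If the Laurent series ring over `B` is left serial, then `B` is left Noetherian. -/
theorem isNoetherianRing_of_isLeftSerialRing (h : IsLeftSerialRing (LaurentSeries B)) :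
    IsNoetherianRing B := by
  obtain ⟨ι, _, N, -, htop, hN⟩ := h
  rw [isNoetherianRing_iff, isNoetherian_iff', WellFoundedGT, isWellFounded_iff,
    RelEmbedding.wellFounded_iff_isEmpty]
  refine ⟨fun I => ?_⟩
  have hI : StrictMono I := fun m n hmn => I.map_rel_iff.2 hmn
  choose a haI ha using fun q => SetLike.exists_of_lt (hI (Nat.lt_succ_self q))
  set n := Fintype.card ι
  obtain ⟨t, hmem, ht⟩ := exists_mem_span_erase_of_card_lt hN Finset.univ (T := Finset.range (n + 1))
    (g := fun t => squareSeries a fun q => q % (n + 1) = t) (by simp [n]) fun t _ => by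
      rw [Finset.sup_univ_eq_iSup, htop]; trivial
  obtain ⟨c, hc⟩ := (Submodule.mem_span_image_finset_iff_exists_fun _).1 ht
  have key : ∃ Q, ∀ q ≥ Q, q % (n + 1) = t →
      (∑ i, c i • squareSeries a fun q => q % (n + 1) = i).coeff ((q : ℤ) ^ 2) ∈ I q := by
    refine Finset.sum_induction _ (fun f : LaurentSeries B => ∃ Q, ∀ q ≥ Q, q % (n + 1) = t →
      f.coeff ((q : ℤ) ^ 2) ∈ I q) ?_ ?_ ?_
    · rintro f g ⟨Q, hQ⟩ ⟨Q', hQ'⟩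
      exact ⟨max Q Q', fun q hq hqt => (I q).add_mem (hQ q (le_of_max_le_left hq) hqt)
        (hQ' q (le_of_max_le_right hq) hqt)⟩
    · exact ⟨0, fun q _ _ => (I q).zero_mem⟩
    · rintro ⟨s, hs⟩ -
      refine ⟨(c ⟨s, hs⟩).order.natAbs, fun q hq hqt => ?_⟩
      refine coeff_mul_mem (I q).toAddSubmonoid fun i j hij hi hj => ?_
      obtain ⟨p, hps, rfl, hpa⟩ := exists_of_coeff_squareSeries_ne_zero hj
      rw [hpa]
      refine Ideal.mul_mem_left (I q) _ (hI.monotone (Nat.succ_le_of_lt ?_) (haI p))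
      have hne : p ≠ q := by
        rintro rfl
        exact (Finset.mem_erase.1 hs).1 (hps.symm.trans hqt)
      by_contra hlt
      have hlt : (q : ℤ) + 1 ≤ p := by omega
      refine hi (HahnSeries.coeff_eq_zero_of_lt_order ?_)
      have h1 : -(q : ℤ) ≤ (c ⟨s, hs⟩).order := by omega
      nlinarith
  obtain ⟨Q, hQ⟩ := key
  have hmod : (Q * (n + 1) + t) % (n + 1) = t := by
    rw [Nat.mul_add_mod_self_right]
    exact Nat.mod_eq_of_lt (Finset.mem_range.1 hmem)
  refine ha (Q * (n + 1) + t) ?_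
  have := hQ (Q * (n + 1) + t) (by nlinarith) hmod
  rwa [hc, coeff_squareSeries, if_pos hmod] at this

theorem isUnit_single_sub_single {K : Type*} [CommRing K] {a b : ℤ} (h : a ≠ b) :
    IsUnit (HahnSeries.single a 1 - HahnSeries.single b 1 : LaurentSeries K) := by
  wlog hab : a < b generalizing a b
  · rw [← neg_sub]
    exact (this h.symm (by omega)).neg
  obtain ⟨d, rfl⟩ : ∃ d : ℕ, b = a + (d + 1 : ℕ) := ⟨(b - a - 1).toNat, by omega⟩
  have h1 : IsUnit (HahnSeries.single a 1 : LaurentSeries K) :=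
    IsUnit.of_mul_eq_one (HahnSeries.single (-a) 1) (by simp)
  have h2 : IsUnit (1 - PowerSeries.X ^ (d + 1) : PowerSeries K) := by
    rw [PowerSeries.isUnit_iff_constantCoeff]
    simp
  have h3 := h2.map (HahnSeries.ofPowerSeries ℤ K)
  rw [map_sub, map_one, HahnSeries.ofPowerSeries_X_pow] at h3
  convert h1.mul h3 using 1
  rw [mul_sub, mul_one, HahnSeries.single_mul_single, mul_one]

/-- The ring homomorphism of Laurent series rings given by applying a ring homomorphism to the
coefficients. -/
def mapRingHom {K : Type*} [Ring K] (ψ : K →+* B) : LaurentSeries K →+* LaurentSeries B where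
  toFun f := f.map ψ
  map_one' := by
    rw [← HahnSeries.C_one, HahnSeries.map_C, map_one, HahnSeries.C_one]
  map_mul' f g := HahnSeries.map_mul (ψ : K →ₙ+* B)
  map_zero' := by ext; simp
  map_add' f g := by ext; simp [HahnSeries.coeff_add]

theorem mapRingHom_single {K : Type*} [Ring K] (ψ : K →+* B) (n : ℤ) (b : K) :
    mapRingHom ψ (HahnSeries.single n b) = HahnSeries.single n (ψ b) :=
  HahnSeries.map_single (ψ : ZeroHom K B)

/-- If the Laurent series ring over `B` is left serial, then `B` is left `π`-regular. -/
theorem isLeftPiRegular_of_isLeftSerialRing (h : IsLeftSerialRing (LaurentSeries B)) :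
    IsLeftPiRegular B := by
  obtain ⟨ι, _, N, -, htop, hN⟩ := h
  intro c
  let ψ : Polynomial ℤ →+* B := Polynomial.eval₂RingHom' (Int.castRingHom B) c
    fun a => Int.cast_commute a c
  let φ : LaurentSeries (Polynomial ℤ) →+* LaurentSeries B := mapRingHom ψ
  let F (i : ℕ) : LaurentSeries (Polynomial ℤ) := HahnSeries.single ((i : ℤ) + 1) 1 - HahnSeries.C Polynomial.X
  set n := Fintype.card ι
  obtain ⟨t, htn, ht⟩ := exists_mem_span_erase_of_card_lt hN Finset.univ
    (T := Finset.range (n + 1)) (g := fun t => φ (∏ i ∈ (Finset.range (n + 1)).erase t, F i))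
    (by simp [n]) fun t _ => by rw [Finset.sup_univ_eq_iSup, htop]; trivial
  have hle : φ (∏ i ∈ (Finset.range (n + 1)).erase t, F i) ∈ Ideal.span {φ (F t)} := by
    refine Submodule.span_le.2 ?_ ht
    rintro _ ⟨s, hs, rfl⟩
    have hs := Finset.mem_erase.1 hs
    obtain ⟨g, hg⟩ := Finset.dvd_prod_of_mem F (Finset.mem_erase.2 ⟨hs.1.symm, htn⟩)
    exact Ideal.mem_span_singleton'.2 ⟨φ g, by simp only [hg]; rw [mul_comm, map_mul]⟩
  obtain ⟨r, hr⟩ := Ideal.mem_span_singleton'.1 hle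
  obtain ⟨u, v, huv⟩ : IsCoprime (∏ i ∈ (Finset.range (n + 1)).erase t, F i) (F t) := by
    refine IsCoprime.prod_left fun i hi => ?_
    have hit : (i : ℤ) + 1 ≠ t + 1 := by
      have := (Finset.mem_erase.1 hi).1
      omega
    obtain ⟨w, hw⟩ := (isUnit_single_sub_single (K := Polynomial ℤ) hit).exists_left_inv
    exact ⟨w, -w, by rw [← hw]; simp only [F]; ring⟩
  set h := φ u * r + φ v with hh
  have hmul : h * (HahnSeries.single ((t : ℤ) + 1) 1 - HahnSeries.C c) = 1 := by
    have hF : φ (F t) = HahnSeries.single ((t : ℤ) + 1) 1 - HahnSeries.C c := by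
      have hs : ∀ m b, φ (HahnSeries.single m b) = HahnSeries.single m (ψ b) := mapRingHom_single ψ
      rw [map_sub, HahnSeries.C_apply, HahnSeries.C_apply, hs, hs, map_one]
      simp [ψ]
    rw [← hF, hh, add_mul, mul_assoc, hr, ← map_mul, ← map_mul, ← map_add, huv, map_one]
  have hcoeff : ∀ m, h.coeff (m - (t + 1)) = (if m = 0 then 1 else 0) + h.coeff m * c := by
    intro m
    have := congrArg (HahnSeries.coeff · m) hmul
    simp only [mul_sub, HahnSeries.coeff_sub, coeff_mul_C, HahnSeries.coeff_mul_single, mul_one,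
      HahnSeries.coeff_one] at this
    convert eq_add_of_sub_eq this
  have hpow : ∀ j : ℕ, h.coeff (-(j + 1) * (t + 1)) = (1 + h.coeff 0 * c) * c ^ j := by
    intro j
    induction j with
    | zero =>
      have := hcoeff 0
      rw [if_pos rfl] at this
      rw [pow_zero, mul_one, ← this]
      congr 1
      push_cast
      ring
    | succ j ih =>
      have := hcoeff (-(j + 1) * (t + 1))
      rw [if_neg (by rw [mul_eq_zero]; omega), zero_add, ih, mul_assoc, ← pow_succ] at this
      rw [← this]
      congr 1
      push_cast
      ring
  refine ⟨h.order.natAbs, -h.coeff 0, ?_⟩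
  have h0 := hpow h.order.natAbs
  rw [HahnSeries.coeff_eq_zero_of_lt_order (by
    have : -(h.order.natAbs : ℤ) ≤ h.order := by omega
    have h3 : (0 : ℤ) ≤ t := by positivity
    have h4 : (0 : ℤ) ≤ h.order.natAbs := by positivity
    nlinarith)] at h0
  rw [add_mul, one_mul, mul_assoc, ← pow_succ'] at h0
  rw [neg_mul]
  exact eq_neg_of_add_eq_zero_left h0.symm

theorem isNilpotent_of_mem_coeffIdeal {J : Ideal B} (hJ : IsNilpotent J) {f : LaurentSeries B}
    (hf : f ∈ coeffIdeal J) : IsNilpotent f := by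
  obtain ⟨m, hm⟩ := hJ
  have : ∀ m, f ^ m ∈ coeffIdeal (J ^ m) := by
    intro m
    induction m with
    | zero => simp [Submodule.pow_zero, mem_coeffIdeal, Ideal.one_eq_top]
    | succ m ih =>
      rcases Nat.eq_zero_or_pos m with rfl | h
      · simpa [Submodule.pow_one] using hf
      · rw [Submodule.pow_succ, _root_.pow_succ]
        exact fun n => coeff_mul_mem (J ^ m * J).toAddSubmonoid fun i j _ _ _ =>
          Ideal.mul_mem_mul (ih i) (hf j)
  refine ⟨m, HahnSeries.ext (funext fun n => ?_)⟩
  have h0 := this m n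
  rwa [hm] at h0

theorem isUnit_of_coeff_mem {J : Ideal B} (hJ : IsNilpotent J) {u : LaurentSeries B} {k : ℤ}
    (hu : u.coeff k = 1) (hu' : ∀ n < k, u.coeff n ∈ J) : IsUnit u := by
  have hx : IsUnit (HahnSeries.single (-k) 1 : LaurentSeries B) :=
    ⟨⟨HahnSeries.single (-k) 1, HahnSeries.single k 1, by simp, by simp⟩, rfl⟩
  suffices h : IsUnit (HahnSeries.single (-k) 1 * u) by
    obtain ⟨x, hx⟩ := hx
    rw [← hx] at h
    exact (Units.isUnit_units_mul x u).1 h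
  set v := HahnSeries.single (-k) 1 * u
  have hv : ∀ n, v.coeff n = u.coeff (n + k) := by
    intro n
    rw [HahnSeries.coeff_single_mul, one_mul, sub_neg_eq_add]
  obtain ⟨p, hp⟩ : ∃ p : LaurentSeries B, IsUnit p ∧ v - p ∈ coeffIdeal J := by
    let P : PowerSeries B := PowerSeries.mk fun n => v.coeff n
    have hP : IsUnit P := by
      rw [PowerSeries.isUnit_iff_constantCoeff]
      simp [P, hv, hu]
    refine ⟨_, hP.map (HahnSeries.ofPowerSeries ℤ B), fun n => ?_⟩
    rw [HahnSeries.coeff_sub, PowerSeries.coeff_coe]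
    split_ifs with hn
    · rw [sub_zero, hv]
      exact hu' _ (by omega)
    · simp [P, abs_of_nonneg (not_lt.1 hn)]
  obtain ⟨⟨p, rfl⟩, hp⟩ := hp
  have h1 := (isNilpotent_of_mem_coeffIdeal hJ
    ((coeffIdeal J).mul_mem_left (↑p⁻¹ : LaurentSeries B) hp)).isUnit_one_add
  rw [mul_sub, Units.inv_mul, add_sub_cancel] at h1
  exact (Units.isUnit_units_mul p⁻¹ v).1 h1

/-- If all coefficients of `f` are multiples of its `k`-th coefficient, those before it with factor
in a nilpotent ideal, then `f` and its `k`-th coefficient generate the same left ideal. -/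
theorem span_singleton_eq_span_C {J : Ideal B} (hJ : IsNilpotent J)
    {f : LaurentSeries B} {k : ℤ} (h1 : ∀ n, f.coeff n ∈ Ideal.span {f.coeff k})
    (h2 : ∀ n < k, ∃ j ∈ J, j * f.coeff k = f.coeff n) :
    Ideal.span {f} = Ideal.span {HahnSeries.C (f.coeff k)} := by
  have : ∀ n, ∃ u, u * f.coeff k = f.coeff n ∧ (n ≠ k → f.coeff n = 0 → u = 0) ∧
      (n < k → u ∈ J) ∧ (n = k → u = 1) := by
    intro n
    rcases eq_or_ne n k with rfl | hn
    · exact ⟨1, by simp⟩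
    · by_cases h0 : f.coeff n = 0
      · exact ⟨0, by simp [h0, hn]⟩
      · by_cases hk : n < k
        · obtain ⟨j, hj, hjf⟩ := h2 n hk
          exact ⟨j, by simp [*]⟩
        · obtain ⟨j, hj⟩ := Ideal.mem_span_singleton'.1 (h1 n)
          exact ⟨j, by simp [*]⟩
  choose u hu hu0 huJ hu1 using this
  have hbdd : BddBelow (Function.support u) := by
    refine ⟨min f.order k, fun n hn => ?_⟩
    by_contra! hlt
    obtain ⟨hlt, hltk⟩ := lt_min_iff.1 hlt
    exact hn (hu0 n hltk.ne (HahnSeries.coeff_eq_zero_of_lt_order hlt))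
  set U : LaurentSeries B := HahnSeries.ofSuppBddBelow u hbdd
  have hUf : U * HahnSeries.C (f.coeff k) = f := by
    ext n
    rw [coeff_mul_C]
    exact hu n
  obtain ⟨U', hU'⟩ : IsUnit U := isUnit_of_coeff_mem hJ (hu1 k rfl) huJ
  refine le_antisymm ?_ ?_ <;> rw [Ideal.span_singleton_le_iff_mem, Ideal.mem_span_singleton']
  · exact ⟨U, hUf⟩
  · refine ⟨↑U'⁻¹, ?_⟩
    nth_rw 1 [← hUf]
    rw [← mul_assoc, ← hU', Units.inv_mul, one_mul]

end LaurentSeries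

/-- A non-generator of a uniserial cyclic left ideal `B m` lies in `J m`, when `B ⧸ J` is
semisimple. -/
theorem IsUniserialModule.exists_mem_mul_eq {B : Type*} [Ring B] {J : Ideal B} [J.IsTwoSided]
    [IsSemisimpleRing (B ⧸ J)] {m q : B} (hm : IsUniserialModule B (Ideal.span {m}))
    (hq : q ∈ Ideal.span {m}) (hmq : m ∉ Ideal.span {q}) : ∃ j ∈ J, j * m = q := by
  rw [isUniserialModule_coe_iff] at hm
  have hqm : Ideal.span {q} ≤ Ideal.span {m} := (Ideal.span_singleton_le_iff_mem _).2 hq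
  let ρ : B →ₗ[B] B := LinearMap.toSpanSingleton B B m
  have hρ : ∀ I : Ideal B, Submodule.map ρ I ≤ Ideal.span {m} := by
    rintro I _ ⟨t, -, rfl⟩
    exact Ideal.mem_span_singleton'.2 ⟨t, rfl⟩
  rcases hm _ hqm _ (hρ J) with h | h
  · exact h (Ideal.mem_span_singleton_self q)
  let K : Ideal B := Submodule.comap ρ (Ideal.span {q})
  have hJK : J ≤ K := Submodule.map_le_iff_le_comap.1 h
  have : ComplementedLattice (Set.Ici J) := by
    let l : (B ⧸ J) →ₛₗ[Ideal.Quotient.mk J] (B ⧸ J) :=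
      { toFun := id
        map_add' _ _ := rfl
        map_smul' b x := by
          obtain ⟨x, rfl⟩ := Ideal.Quotient.mk_surjective x
          rfl }
    have : IsSemisimpleModule B (B ⧸ J) :=
      (l.isSemisimpleModule_iff_of_bijective Function.bijective_id).2 ‹_›
    have : ComplementedLattice (Submodule B (B ⧸ J)) := inferInstance
    exact (Submodule.comapMkQRelIso J).complementedLattice
  obtain ⟨⟨K', hK'⟩, hc⟩ := exists_isCompl (⟨K, hJK⟩ : Set.Ici J)
  have hinf : K ⊓ K' = J := congrArg Subtype.val hc.inf_eq_bot
  have hsup : K ⊔ K' = ⊤ := congrArg Subtype.val hc.sup_eq_top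
  rcases hm _ (hρ K) _ (hρ K') with h | h
  · obtain ⟨b, hb⟩ := Ideal.mem_span_singleton'.1 hq
    have hbK : b ∈ K := show b * m ∈ Ideal.span {q} from hb ▸ Ideal.mem_span_singleton_self q
    obtain ⟨b', hb', hbm⟩ := h ⟨b, hbK, rfl⟩
    have hb'q : b' * m = q := hbm.trans hb
    have hb'K : b' ∈ K := show b' * m ∈ Ideal.span {q} from
      hb'q ▸ Ideal.mem_span_singleton_self q
    exact ⟨b', hinf ▸ ⟨hb'K, hb'⟩, hb'q⟩
  · have : Submodule.map ρ ⊤ ≤ Ideal.span {q} := by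
      rw [← hsup, Submodule.map_sup, sup_eq_left.2 h]
      exact Submodule.map_comap_le _ _
    exact absurd (this ⟨1, trivial, one_mul m⟩) hmq

namespace LaurentSeries

variable {B : Type*} [Ring B]

theorem C_mem_span_C {a b : B} (h : a ∈ Ideal.span {b}) :
    (HahnSeries.C a : LaurentSeries B) ∈ Ideal.span {HahnSeries.C b} := by
  obtain ⟨c, rfl⟩ := Ideal.mem_span_singleton'.1 h
  rw [map_mul]
  exact Ideal.mul_mem_left _ _ (Ideal.mem_span_singleton_self _)

theorem mem_span_of_C_mem_span_C {a b : B}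
    (h : (HahnSeries.C a : LaurentSeries B) ∈ Ideal.span {HahnSeries.C b}) :
    a ∈ Ideal.span {b} := by
  obtain ⟨t, ht⟩ := Ideal.mem_span_singleton'.1 h
  refine Ideal.mem_span_singleton'.2 ⟨t.coeff 0, ?_⟩
  rw [← coeff_mul_C, ht, HahnSeries.C_apply, HahnSeries.coeff_single_same]

/-- Over a left Artinian ring, a Laurent series with coefficients in a uniserial left ideal
generates the same left ideal as one of its coefficients. -/
theorem exists_span_singleton_eq_span_C [IsArtinianRing B] {M : Ideal B}
    (hM : IsUniserialModule B M) {f : LaurentSeries B} (hf : f ∈ coeffIdeal M) :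
    ∃ m ∈ M, Ideal.span {f} = Ideal.span {HahnSeries.C m} := by
  by_cases hf0 : f = 0
  · exact ⟨0, M.zero_mem, by simp [hf0]⟩
  obtain ⟨_, ⟨l, rfl⟩, hmax⟩ := WellFounded.has_min (wellFounded_gt (α := Ideal B))
    (Set.range fun n => Ideal.span {f.coeff n}) ⟨_, 0, rfl⟩
  have hcomp := isUniserialModule_coe_iff_mem_span.1 hM
  have hl : ∀ n, Ideal.span {f.coeff n} ≤ Ideal.span {f.coeff l} := by
    intro n
    have hle := hmax _ ⟨n, rfl⟩
    rcases hcomp _ (hf n) _ (hf l) with h | h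
    · exact (Ideal.span_singleton_le_iff_mem _).2 h
    · exact (eq_of_le_of_not_lt ((Ideal.span_singleton_le_iff_mem _).2 h) hle).ge
  obtain ⟨k, hk, hkmin⟩ := Int.exists_least_of_bdd
    (P := fun k => Ideal.span {f.coeff k} = Ideal.span {f.coeff l}) ⟨f.order, fun n hn => by
      by_contra! hlt
      rw [HahnSeries.coeff_eq_zero_of_lt_order hlt] at hn
      refine hf0 (HahnSeries.ext (funext fun m => ?_))
      have := hl m
      rw [← hn] at this
      simpa using this⟩ ⟨l, rfl⟩
  have hkm : ∀ n, f.coeff n ∈ Ideal.span {f.coeff k} := fun n =>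
    (Ideal.span_singleton_le_iff_mem _).1 (hk ▸ hl n)
  refine ⟨f.coeff k, hf k, span_singleton_eq_span_C
    (IsSemiprimaryRing.isNilpotent (R := B)) hkm fun n hn => ?_⟩
  have huni : IsUniserialModule B (Ideal.span {f.coeff k}) := by
    rw [isUniserialModule_coe_iff] at hM ⊢
    have hle : Ideal.span {f.coeff k} ≤ M := (Ideal.span_singleton_le_iff_mem _).2 (hf k)
    exact fun P hP Q hQ => hM P (hP.trans hle) Q (hQ.trans hle)
  have := IsSemiprimaryRing.isSemisimpleRing (R := B)
  refine huni.exists_mem_mul_eq (hkm n) fun hmem => ?_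
  have := hkmin n (hk ▸ le_antisymm ((Ideal.span_singleton_le_iff_mem _).2 (hkm n))
    ((Ideal.span_singleton_le_iff_mem _).2 hmem))
  omega

theorem isUniserialModule_coeffIdeal [IsArtinianRing B] {M : Ideal B}
    (hM : IsUniserialModule B M) : IsUniserialModule (LaurentSeries B) (coeffIdeal M) := by
  rw [isUniserialModule_coe_iff_mem_span]
  intro f hf g hg
  obtain ⟨a, ha, hfa⟩ := exists_span_singleton_eq_span_C hM hf
  obtain ⟨b, hb, hgb⟩ := exists_span_singleton_eq_span_C hM hg
  change f ∈ Ideal.span {g} ∨ g ∈ Ideal.span {f}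
  rw [← Ideal.span_singleton_le_iff_mem, ← Ideal.span_singleton_le_iff_mem, hfa, hgb,
    Ideal.span_singleton_le_iff_mem, Ideal.span_singleton_le_iff_mem]
  exact (isUniserialModule_coe_iff_mem_span.1 hM a ha b hb).imp C_mem_span_C C_mem_span_C

theorem isNoetherian_coeffIdeal [IsArtinianRing B] {M : Ideal B}
    (hM : IsUniserialModule B M) : IsNoetherian (LaurentSeries B) (coeffIdeal M) := by
  rw [isNoetherian_iff']
  let F (P : Submodule (LaurentSeries B) (coeffIdeal M)) : Ideal B :=
    Ideal.comap HahnSeries.C (Submodule.map (coeffIdeal M).subtype P)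
  have hF : Monotone F := fun P Q h => Ideal.comap_mono (Submodule.map_mono h)
  refine StrictMono.wellFoundedGT (f := F) fun P Q h =>
    lt_of_le_not_ge (hF h.le) fun hle => h.not_ge ?_
  rintro ⟨f, hfM⟩ hf
  obtain ⟨a, ha, hfa⟩ := exists_span_singleton_eq_span_C hM hfM
  have haQ : a ∈ F Q := by
    have h1 : Ideal.span {f} ≤ Submodule.map (coeffIdeal M).subtype Q :=
      (Ideal.span_singleton_le_iff_mem _).2 ⟨⟨f, hfM⟩, hf, rfl⟩
    rw [hfa] at h1
    exact h1 (Ideal.mem_span_singleton_self _)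
  have haP : HahnSeries.C a ∈ Submodule.map (coeffIdeal M).subtype P := hle haQ
  rw [← Ideal.span_singleton_le_iff_mem, ← hfa, Ideal.span_singleton_le_iff_mem] at haP
  obtain ⟨f', hf', rfl⟩ := haP
  exact hf'

theorem iSupIndep_coeffIdeal {ι : Type*} {M : ι → Ideal B} (h : iSupIndep M) :
    iSupIndep fun i => coeffIdeal (M i) := by
  intro i
  refine Disjoint.mono_right (b := ⨆ j, ⨆ (_ : j ≠ i), coeffIdeal (M j))
    (c := coeffIdeal (⨆ j, ⨆ (_ : j ≠ i), M j))
    (iSup₂_le fun j hj => coeffIdeal_mono (le_iSup₂ (f := fun j (_ : j ≠ i) => M j) j hj)) ?_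
  refine Submodule.disjoint_def.2 fun f hf hf' => HahnSeries.ext (funext fun n => ?_)
  exact Submodule.disjoint_def.1 (h i) _ (hf n) (hf' n)

theorem iSup_coeffIdeal {ι : Type*} {M : ι → Ideal B} (h : ⨆ i, M i = ⊤) :
    ⨆ i, coeffIdeal (M i) = ⊤ := by
  rw [← Ideal.comap_eq_top_iff (f := HahnSeries.C), eq_top_iff, ← h]
  exact iSup_le fun i b hb => (le_iSup (fun i => coeffIdeal (M i)) i) (C_mem_coeffIdeal hb)

theorem isLeftSerialRing [IsArtinianRing B] (h : IsLeftSerialRing B) :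
    IsLeftSerialRing (LaurentSeries B) := by
  obtain ⟨ι, hι, M, hind, htop, hM⟩ := h
  exact ⟨ι, hι, fun i => coeffIdeal (M i), iSupIndep_coeffIdeal hind, iSup_coeffIdeal htop,
    fun i => isUniserialModule_coeffIdeal (hM i)⟩

theorem isNoetherianRing [IsArtinianRing B] (h : IsLeftSerialRing B) :
    IsNoetherianRing (LaurentSeries B) := by
  obtain ⟨ι, hι, M, -, htop, hM⟩ := h
  have := fun i => isNoetherian_coeffIdeal (hM i)
  rw [isNoetherianRing_iff, ← isNoetherian_top_iff, ← iSup_coeffIdeal htop]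
  infer_instance

/-- If the Laurent series ring over a left Artinian ring `B` is left serial, then indecomposable
left ideals of `B` that are direct summands are uniserial. -/
theorem isUniserialModule_of_isLeftSerialRing [IsArtinianRing B]
    (h : IsLeftSerialRing (LaurentSeries B)) {M M' : Ideal B} (hM : IsLatticeIndecomposable M)
    (hc : IsCompl M M') : IsUniserialModule B M := by
  have hR := isLeftPiRegular_of_isLeftSerialRing h
  obtain ⟨ι, _, U, -, htop, hU⟩ := h
  obtain ⟨e, he, e', he', hee⟩ := Submodule.mem_sup.1
    (hc.sup_eq_top ▸ Submodule.mem_top : (1 : B) ∈ M ⊔ M')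
  have hMe : ∀ a ∈ M, a * e = a := by
    intro a ha
    have h1 : a - a * e = a * e' := by rw [sub_eq_iff_eq_add', ← mul_add, hee, mul_one]
    refine (sub_eq_zero.1 (Submodule.disjoint_def.1 hc.disjoint _
      (M.sub_mem ha (M.mul_mem_left a he)) (h1 ▸ M'.mul_mem_left a he'))).symm
  have heJ : e ∉ Ring.jacobson B := by
    intro hJ
    obtain ⟨n, hn⟩ := hR.isNilpotent_of_mem_jacobson hJ
    have h0 : e = 0 := by
      have hi : IsIdempotentElem e := hMe e he
      rw [← hi.pow_succ_eq n, pow_succ, hn, zero_mul]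
    refine hM.1 ((Submodule.eq_bot_iff _).2 fun a ha => ?_)
    rw [← hMe a ha, h0, mul_zero]
  obtain ⟨j, u, huj, hu⟩ : ∃ j, ∃ u ∈ U j, u * HahnSeries.C e ∉ coeffIdeal (Ring.jacobson B) := by
    by_contra! hall
    have hle : ⨆ j, U j ≤ Submodule.comap (LinearMap.toSpanSingleton (LaurentSeries B) _
      (HahnSeries.C e)) (coeffIdeal (Ring.jacobson B)) := iSup_le fun j u hu => hall j u hu
    have h1 : 1 * HahnSeries.C e ∈ coeffIdeal (Ring.jacobson B) :=
      hle (htop ▸ Submodule.mem_top : (1 : LaurentSeries B) ∈ _)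
    have h2 := h1 0
    rw [coeff_mul_C, HahnSeries.coeff_one, if_pos rfl, one_mul] at h2
    exact heJ h2
  set f := u * HahnSeries.C e with hf
  have hfM : ∀ n, f.coeff n ∈ M := fun n => by
    rw [hf, coeff_mul_C]
    exact M.mul_mem_left _ he
  rw [mem_coeffIdeal] at hu
  push Not at hu
  obtain ⟨k, hk, hkmin⟩ := Int.exists_least_of_bdd
    (P := fun k => f.coeff k ∉ Ring.jacobson B) ⟨f.order, fun n hn => by
      by_contra! hlt
      rw [HahnSeries.coeff_eq_zero_of_lt_order hlt] at hn
      exact hn (zero_mem _)⟩ hu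
  have hspan : Ideal.span {f.coeff k} = M :=
    (hM.eq_or_le_jacobson hR ((Ideal.span_singleton_le_iff_mem _).2 (hfM k))).resolve_right
      fun hle => hk (hle (Ideal.mem_span_singleton_self _))
  have hfk : Ideal.span {f} = Ideal.span {HahnSeries.C (f.coeff k)} := by
    refine span_singleton_eq_span_C (IsSemiprimaryRing.isNilpotent (R := B))
      (fun n => hspan ▸ hfM n) fun n hn => ?_
    have hnJ : f.coeff n ∈ Ring.jacobson B := by
      by_contra hnJ
      exact absurd (hkmin n hnJ) (by omega)
    obtain ⟨b, hb⟩ := Ideal.mem_span_singleton'.1 (hspan ▸ he : e ∈ Ideal.span {f.coeff k})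
    exact ⟨f.coeff n * b, Ideal.mul_mem_right _ _ hnJ, by rw [mul_assoc, hb, hMe _ (hfM n)]⟩
  have hfac : ∀ a ∈ M, ∃ r ∈ U j, r * HahnSeries.C e = HahnSeries.C a := by
    intro a ha
    have h1 := C_mem_span_C (hspan ▸ ha : a ∈ Ideal.span {f.coeff k})
    rw [← hfk] at h1
    obtain ⟨r, hr⟩ := Ideal.mem_span_singleton'.1 h1
    exact ⟨r * u, (U j).smul_mem r huj, by rw [mul_assoc, ← hf, hr]⟩
  have hcomp : ∀ r s : LaurentSeries B, ∀ a b : B, r * HahnSeries.C e = HahnSeries.C a →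
      s * HahnSeries.C e = HahnSeries.C b → r ∈ Ideal.span {s} → a ∈ Ideal.span {b} := by
    intro r s a b hr hs hrs
    obtain ⟨t, rfl⟩ := Ideal.mem_span_singleton'.1 hrs
    refine mem_span_of_C_mem_span_C ?_
    rw [← hr, mul_assoc, hs]
    exact Ideal.mul_mem_left _ _ (Ideal.mem_span_singleton_self _)
  rw [isUniserialModule_coe_iff_mem_span]
  intro a ha b hb
  obtain ⟨r, hrU, hr⟩ := hfac a ha
  obtain ⟨s, hsU, hs⟩ := hfac b hb
  exact (isUniserialModule_coe_iff_mem_span.1 (hU j) r hrU s hsU).imp (hcomp _ _ _ _ hr hs)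
    (hcomp _ _ _ _ hs hr)

theorem isLeftSerialRing_of_isLeftSerialRing [IsArtinianRing B]
    (h : IsLeftSerialRing (LaurentSeries B)) : IsLeftSerialRing B := by
  classical
  obtain ⟨S, hind, htop, hS⟩ := exists_supIndep_indecomposable (⊤ : Ideal B)
  have hind' : iSupIndep fun M : S => (M : Ideal B) := by
    rw [iSupIndep_iff_supIndep_univ, Finset.univ_eq_attach]
    exact Finset.supIndep_attach.2 hind
  refine ⟨Fin S.card, inferInstance, fun i => (S.equivFin.symm i : Ideal B),
    hind'.comp S.equivFin.symm.injective, ?_, fun i => ?_⟩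
  · rw [S.equivFin.symm.iSup_comp (g := fun M : S => (M : Ideal B)), iSup_subtype, ← htop,
      Finset.sup_id_eq_sSup, sSup_eq_iSup]
    rfl
  · have hi := (S.equivFin.symm i).2
    refine isUniserialModule_of_isLeftSerialRing h (M' := (S.erase _).sup id) (hS _ hi)
      ⟨hind (Finset.erase_subset _ _) hi (Finset.notMem_erase _ _), codisjoint_iff.2 ?_⟩
    rw [← htop]
    conv_rhs => rw [← Finset.insert_erase hi, Finset.sup_insert, id]

end LaurentSeries

/-- Right ideals of a ring correspond to left ideals of an opposite ring. -/
def rightIdealOrderIso {R B : Type*} [Ring R] [Ring B] (σ : Rᵐᵒᵖ ≃+* B) :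
    Submodule Rᵐᵒᵖ R ≃o Submodule B B :=
  letI := RingHomInvPair.of_ringEquiv σ
  letI := RingHomInvPair.of_ringEquiv σ.symm
  Submodule.orderIsoMapComap
    ({ (MulOpposite.opAddEquiv (α := R)).trans σ.toAddEquiv with
       map_smul' := fun r x => by
        change σ (MulOpposite.op (r • x)) = σ r * σ (MulOpposite.op x)
        rw [← map_mul]
        rfl } : R ≃ₛₗ[(σ : Rᵐᵒᵖ →+* B)] B)

theorem isUniserialModule_coe_iff_of_orderIso {R M S N : Type*} [Ring R] [AddCommGroup M]
    [Module R M] [Ring S] [AddCommGroup N] [Module S N] (e : Submodule R M ≃o Submodule S N)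
    (P : Submodule R M) : IsUniserialModule S (e P) ↔ IsUniserialModule R P := by
  simp_rw [isUniserialModule_coe_iff, e.surjective.forall, e.le_iff_le]

theorem isRightSerialRing_iff_isLeftSerialRing {R B : Type*} [Ring R] [Ring B]
    (σ : Rᵐᵒᵖ ≃+* B) : IsRightSerialRing R ↔ IsLeftSerialRing B := by
  let e := rightIdealOrderIso σ
  constructor
  · rintro ⟨ι, hι, N, hind, htop, hN⟩
    refine ⟨ι, hι, fun i => e (N i), (iSupIndep_map_orderIso_iff e).2 hind, ?_, fun i => ?_⟩
    · rw [← e.map_iSup, htop, e.map_top]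
    · exact (isUniserialModule_coe_iff_of_orderIso e _).2 (hN i)
  · rintro ⟨ι, hι, N, hind, htop, hN⟩
    refine ⟨ι, hι, fun i => e.symm (N i), (iSupIndep_map_orderIso_iff e.symm).2 hind, ?_,
      fun i => ?_⟩
    · rw [← e.symm.map_iSup, htop, e.symm.map_top]
    · exact (isUniserialModule_coe_iff_of_orderIso e.symm _).2 (hN i)

namespace LaurentSeries

open MulOpposite

/-- The Laurent series ring over the opposite ring is the opposite of the Laurent series ring. -/
def opRingEquiv (A : Type*) [Ring A] : (LaurentSeries A)ᵐᵒᵖ ≃+* LaurentSeries Aᵐᵒᵖ where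
  toFun f := f.unop.map (opAddEquiv (α := A))
  invFun f := op (f.map (opAddEquiv (α := A)).symm)
  left_inv f := by
    apply unop_injective
    ext n
    simp
  right_inv f := by
    ext n
    simp
  map_add' f g := by
    ext n
    simp [HahnSeries.coeff_add]
  map_mul' f g := by
    ext n
    change opAddEquiv (α := A) ((g.unop * f.unop).coeff n) = _
    rw [HahnSeries.coeff_mul, HahnSeries.coeff_mul, map_sum]
    refine Finset.sum_nbij' Prod.swap Prod.swap ?_ ?_ ?_ ?_ ?_
    · rintro ⟨i, j⟩ h
      simp only [Finset.mem_antidiagonal, HahnSeries.mem_support] at h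
      simpa [add_comm j i] using And.intro h.2.1 (And.intro h.1 h.2.2)
    · rintro ⟨i, j⟩ h
      simp only [Finset.mem_antidiagonal, HahnSeries.mem_support] at h
      simpa [add_comm j i] using And.intro h.2.1 (And.intro h.1 h.2.2)
    · simp
    · simp
    · simp

end LaurentSeries

/-- The Laurent series ring `A((x))` is a right serial ring with the maximum
condition on right annihilators if and only if `A` is a right serial right
Artinian ring. -/
theorem laurentSeries_rightSerial_acc_annihilators_iff (A : Type*) [Ring A] :
    (IsRightSerialRing (LaurentSeries A) ∧
        HasMaxConditionOnRightAnnihilators (LaurentSeries A)) ↔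
      (IsRightSerialRing A ∧ IsArtinian Aᵐᵒᵖ A) := by
  have hart : IsArtinian Aᵐᵒᵖ A ↔ IsArtinianRing Aᵐᵒᵖ := by
    let e := rightIdealOrderIso (RingEquiv.refl Aᵐᵒᵖ)
    exact ⟨fun _ => e.symm.strictMono.wellFoundedLT, fun _ => e.strictMono.wellFoundedLT⟩
  rw [isRightSerialRing_iff_isLeftSerialRing (LaurentSeries.opRingEquiv A),
    isRightSerialRing_iff_isLeftSerialRing (RingEquiv.refl Aᵐᵒᵖ), hart]
  constructor
  · rintro ⟨h, -⟩
    have := LaurentSeries.isNoetherianRing_of_isLeftSerialRing h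
    have := (LaurentSeries.isLeftPiRegular_of_isLeftSerialRing h).isArtinianRing
    exact ⟨LaurentSeries.isLeftSerialRing_of_isLeftSerialRing h, this⟩
  · rintro ⟨h, _⟩
    refine ⟨LaurentSeries.isLeftSerialRing h, ?_⟩
    rintro ⟨f, -, hf⟩
    have := LaurentSeries.isNoetherianRing h
    exact not_strictMono_of_wellFoundedGT _
      ((rightIdealOrderIso (LaurentSeries.opRingEquiv A)).strictMono.comp hf)
end
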